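/- arXiv:2406.17486 — 2 statements merged into one kernel-verified Lean document; each statement's English description precedes it below -/
import Mathlib

section
/- Let K ∈ ℕ and ε > 0 be fixed constants. Let (G_n)_{n∈ℕ} be a sequence of finite graphs with G_n ∈ H(K) for every n and δ(G_n) → ∞ as n → ∞, and let p = p(n) ∈ [0,1] satisfy p(n) > 1/2 − (1/2 − ε)·√(log Δ(G_n)/Δ(G_n)) for all n. Then Φ(p(n), G_n) → 1 as n → ∞; that is, the probability that a p(n)-random initial set percolates in majority bootstrap percolation on G_n tends to 1. -/
open SimpleGraph Filter

namespace MBP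

/-- Degree of a vertex, via the cardinality of its neighbourhood. -/
noncomputable def deg {V : Type} (G : SimpleGraph V) (x : V) : ℕ :=
  (G.neighborSet x).ncard

/-- Minimum degree. -/
noncomputable def minDeg {V : Type} (G : SimpleGraph V) : ℕ :=
  sInf (Set.range (deg G))

/-- Maximum degree. -/
noncomputable def maxDeg {V : Type} (G : SimpleGraph V) : ℕ :=
  sSup (Set.range (deg G))

/-- Ball of radius `ℓ` around `x`. -/
def ball {V : Type} (G : SimpleGraph V) (x : V) (ℓ : ℕ) : Set V :=
  {y | G.edist x y ≤ ℓ}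

/-- Sphere of radius `ℓ` around `x` (for `ℓ ≥ 1` this is `B(x,ℓ) \ B(x,ℓ-1)`). -/
def sphere {V : Type} (G : SimpleGraph V) (x : V) (ℓ : ℕ) : Set V :=
  {y | G.edist x y = ℓ}

/-- (P1) locally K-almost regular. -/
def P1 (K : ℕ) {V : Type} (G : SimpleGraph V) : Prop :=
  ∀ (x : V) (ℓ : ℕ), 1 ≤ ℓ → ∀ y ∈ sphere G x ℓ,
    |(deg G x : ℤ) - (deg G y : ℤ)| ≤ (K : ℤ) * ℓ

/-- (P2) K-bounded backwards expansion. -/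
def P2 (K : ℕ) {V : Type} (G : SimpleGraph V) : Prop :=
  ∀ (x : V) (ℓ : ℕ), 1 ≤ ℓ → ∀ y ∈ sphere G x ℓ,
    (G.neighborSet y ∩ ball G x ℓ).ncard ≤ K * ℓ

/-- `D` witnesses property (P3) (typical local structure and K-separation) at vertex `x`. -/
def P3At (K : ℕ) {V : Type} (G : SimpleGraph V) (x : V) (D : Set V) : Prop :=
  x ∉ D ∧ ∀ (ℓ : ℕ), 1 ≤ ℓ →
    ((D ∩ sphere G x ℓ).ncard ≤ K ^ (ℓ - 1) * (deg G x) ^ (ℓ - 1)) ∧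
    (∀ y ∈ sphere G x ℓ \ D, (D ∩ G.neighborSet y).ncard ≤ K * ℓ) ∧
    (∀ y ∈ sphere G x ℓ \ D, ∀ z ∈ sphere G x ℓ \ D, y ≠ z →
      (G.neighborSet y ∩ G.neighborSet z ∩ (sphere G x (ℓ + 1) \ D)).ncard ≤ 1) ∧
    (∀ y ∈ sphere G x ℓ \ D,
      (ball G y (2 * ℓ - 1) ∩ (sphere G x ℓ \ D)).ncard ≤ ℓ * K ^ (ℓ - 1) * (deg G x) ^ (ℓ - 1))

/-- (P3) typical local structure and K-separation. -/
def P3 (K : ℕ) {V : Type} (G : SimpleGraph V) : Prop :=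
  ∀ x : V, ∃ D : Set V, P3At K G x D

/-- (P5) exponential order. -/
def P5 (K : ℕ) {V : Type} (G : SimpleGraph V) : Prop :=
  (Nat.card V : ℝ) ≤ Real.exp (K * minDeg G)

/-- (P4) K-projection, relative to a membership predicate `mem` for the projected subgraphs. -/
def P4With (K : ℕ) {V : Type} (G : SimpleGraph V) (mem : G.Subgraph → Prop) : Prop :=
  ∀ (x : V) (ℓ : ℕ), 1 ≤ ℓ → ∀ y ∈ sphere G x ℓ,
    ∃ H : G.Subgraph, y ∈ H.verts ∧ mem H ∧
      H.verts ∩ ball G x (ℓ - 1) = ∅ ∧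
      ∀ w : H.verts, |(deg H.coe w : ℤ) - (deg G (w : V) : ℤ)| ≤ (K : ℤ) * ℓ

/-- Membership in the class H(K) with recursion fuel `n`. -/
def HAux (K : ℕ) : ℕ → (V : Type) → SimpleGraph V → Prop
  | 0, V, _ => Nat.card V = 1
  | n + 1, V, G =>
      Nat.card V = 1 ∨
        (P1 K G ∧ P2 K G ∧ P3 K G ∧ P4With K G (fun H => HAux K n H.verts H.coe) ∧ P5 K G)

/-- The class `H(K)` of geometric graphs: least class containing the one-vertex graph and
closed under properties (P1)–(P5), where the projections of (P4) again lie in the class. -/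
def InH (K : ℕ) {V : Type} (G : SimpleGraph V) : Prop :=
  ∃ n, HAux K n V G

/-- One round of majority bootstrap percolation: a vertex `v` becomes infected if at least
`d(v)/2` of its neighbours are infected. -/
def bootStep {V : Type} (G : SimpleGraph V) (A : Set V) : Set V :=
  A ∪ {v | (deg G v : ℝ) / 2 ≤ ((G.neighborSet v ∩ A).ncard : ℝ)}

/-- The majority bootstrap percolation process. -/
def bootIter {V : Type} (G : SimpleGraph V) (A0 : Set V) : ℕ → Set V
  | 0 => A0
  | n + 1 => bootStep G (bootIter G A0 n)

/-- `A0` percolates if eventually every vertex is infected. -/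
def Percolates {V : Type} (G : SimpleGraph V) (A0 : Set V) : Prop :=
  (⋃ i, bootIter G A0 i) = Set.univ

/-- Weight of a subset `A` under the `p`-random measure. -/
noncomputable def weight {V : Type} (p : ℝ) (A : Set V) : ℝ :=
  p ^ A.ncard * (1 - p) ^ (Aᶜ).ncard

/-- Probability that a `p`-random subset of `V` satisfies the event `E`. -/
noncomputable def prob {V : Type} (p : ℝ) (E : Set V → Prop) : ℝ :=
  ∑ᶠ A ∈ {A : Set V | E A}, weight p A

/-- Probability that a `p`-random initial set percolates. -/
noncomputable def Phi {V : Type} (p : ℝ) (G : SimpleGraph V) : ℝ :=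
  prob p (fun A0 => Percolates G A0)

/-- One round of the `m`-shifted bootstrap process (threshold `d(v)/2 + m`). -/
def bootStepM {V : Type} (G : SimpleGraph V) (m : ℕ) (A : Set V) : Set V :=
  A ∪ {v | (deg G v : ℝ) / 2 + m ≤ ((G.neighborSet v ∩ A).ncard : ℝ)}

/-- The `m`-shifted bootstrap process. -/
def bootIterM {V : Type} (G : SimpleGraph V) (m : ℕ) (A0 : Set V) : ℕ → Set V
  | 0 => A0
  | n + 1 => bootStepM G m (bootIterM G m A0 n)

/-- `σ(x) = √(log d(x) / d(x))`. -/
noncomputable def sigma' {V : Type} (G : SimpleGraph V) (x : V) : ℝ :=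
  Real.sqrt (Real.log (deg G x) / (deg G x))

/-- `γ(x) = √(d(x) / √(log d(x)))`. -/
noncomputable def gamma' {V : Type} (G : SimpleGraph V) (x : V) : ℝ :=
  Real.sqrt ((deg G x : ℝ) / Real.sqrt (Real.log (deg G x)))

/-- The `Boot₂(γ)` process: in the step from round `ℓ` to round `ℓ+1`, a vertex `v` becomes
infected if at least `d(v)/2 - max(0, 2-ℓ)·γ(v)` of its neighbours are infected. -/
noncomputable def hatIter {V : Type} (G : SimpleGraph V) (A0 : Set V) : ℕ → Set V
  | 0 => A0
  | ℓ + 1 =>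
      hatIter G A0 ℓ ∪
        {v | (deg G v : ℝ) / 2 - ((2 - ℓ : ℕ) : ℝ) * gamma' G v
              ≤ ((G.neighborSet v ∩ hatIter G A0 ℓ).ncard : ℝ)}

/-- Expectation of `f` restricted to the event `E`, under the `p`-random measure. -/
noncomputable def expOn {V : Type} (p : ℝ) (E : Set V → Prop) (f : Set V → ℝ) : ℝ :=
  ∑ᶠ A ∈ {A : Set V | E A}, weight p A * f A

/-- Conditional expectation of `f` given the event `E`. -/
noncomputable def condExp {V : Type} (p : ℝ) (E : Set V → Prop) (f : Set V → ℝ) : ℝ :=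
  expOn p E f / prob p E

/-- Conditional variance of `f` given the event `E`. -/
noncomputable def condVar {V : Type} (p : ℝ) (E : Set V → Prop) (f : Set V → ℝ) : ℝ :=
  condExp p E (fun A => (f A - condExp p E f) ^ 2)

/-- The number of edges between `U` and `W` (ordered pairs `(u,w)` with `u ∈ U`, `w ∈ W`
adjacent; for disjoint sets this is the number of edges with one endpoint in each). -/
noncomputable def eBetween {V : Type} (G : SimpleGraph V) (U W : Set V) : ℕ :=
  {e : V × V | e.1 ∈ U ∧ e.2 ∈ W ∧ G.Adj e.1 e.2}.ncard

/-- Upper tail `Pr[Bin(d,p) ≥ t]` of the binomial distribution. -/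
noncomputable def binTail (d : ℕ) (p : ℝ) (t : ℝ) : ℝ :=
  ∑ k ∈ Finset.range (d + 1),
    if t ≤ (k : ℝ) then (d.choose k : ℝ) * p ^ k * (1 - p) ^ (d - k) else 0

/-! ### Finite probability framework -/

section Framework

open Classical Finset

variable {V : Type} [Fintype V]

set_option linter.unusedSectionVars false

noncomputable def wt (p : ℝ) (S A : Finset V) : ℝ := p ^ A.card * (1 - p) ^ (S.card - A.card)

noncomputable def Ex (p : ℝ) (f : Finset V → ℝ) : ℝ := ∑ A : Finset V, wt p univ A * f A

noncomputable def ind (P : Prop) : ℝ := if P then 1 else 0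

lemma ind_pos {P : Prop} (h : P) : ind P = 1 := by simp [ind, h]

lemma ind_neg {P : Prop} (h : ¬ P) : ind P = 0 := by simp [ind, h]

lemma ind_nonneg (P : Prop) : 0 ≤ ind P := by unfold ind; split_ifs <;> norm_num

lemma sum_ind {ι : Type*} (I : Finset ι) (P : ι → Prop) [DecidablePred P] :
    ∑ i ∈ I, ind (P i) = ((I.filter P).card : ℝ) := by
  rw [card_filter]
  push_cast
  exact sum_congr rfl fun i _ => by by_cases h : P i <;> simp [ind, h]

noncomputable def Pr (p : ℝ) (E : Finset V → Prop) : ℝ := Ex p (fun A => ind (E A))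

def Dep {β : Type} (S : Finset V) (f : Finset V → β) : Prop :=
  ∀ A B : Finset V, A ∩ S = B ∩ S → f A = f B

lemma wt_nonneg {p : ℝ} (h0 : 0 ≤ p) (h1 : p ≤ 1) (S A : Finset V) : 0 ≤ wt p S A := by
  have : 0 ≤ 1 - p := by linarith
  unfold wt; positivity

lemma Ex_add (p : ℝ) (f g : Finset V → ℝ) : Ex p (fun A => f A + g A) = Ex p f + Ex p g := by
  simp [Ex, mul_add, sum_add_distrib]

lemma Ex_sum {ι : Type*} (p : ℝ) (I : Finset ι) (f : ι → Finset V → ℝ) :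
    Ex p (fun A => ∑ i ∈ I, f i A) = ∑ i ∈ I, Ex p (f i) := by
  simp only [Ex, mul_sum]
  rw [sum_comm]

lemma Ex_smul (p c : ℝ) (f : Finset V → ℝ) : Ex p (fun A => c * f A) = c * Ex p f := by
  simp only [Ex, mul_sum]
  exact sum_congr rfl fun A _ => by ring

lemma Ex_mono {p : ℝ} (h0 : 0 ≤ p) (h1 : p ≤ 1) {f g : Finset V → ℝ} (h : ∀ A, f A ≤ g A) :
    Ex p f ≤ Ex p g :=
  sum_le_sum fun A _ => mul_le_mul_of_nonneg_left (h A) (wt_nonneg h0 h1 _ _)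

lemma Ex_const (p c : ℝ) : Ex (V := V) p (fun _ => c) = c := by
  have h := Finset.sum_pow_mul_eq_add_pow p (1 - p) (univ : Finset V)
  simp only [Ex, wt, ← sum_mul]
  rw [Finset.powerset_univ] at h
  rw [h]; simp

lemma sum_wt (p : ℝ) (S : Finset V) : ∑ B ∈ S.powerset, wt p S B = 1 := by
  have h := Finset.sum_pow_mul_eq_add_pow p (1 - p) S
  simp only [wt]
  rw [h]; simp

lemma Ex_split (p : ℝ) (S : Finset V) (f : Finset V → ℝ) :
    Ex p f = ∑ B ∈ S.powerset, ∑ C ∈ (Sᶜ).powerset, wt p S B * wt p Sᶜ C * f (B ∪ C) := by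
  rw [← sum_product']
  unfold Ex
  symm
  refine sum_nbij' (fun x => x.1 ∪ x.2) (fun A => (A ∩ S, A ∩ Sᶜ)) ?_ ?_ ?_ ?_ ?_
  · intro a _; simp
  · intro A _; simp
  · rintro ⟨B, C⟩ h
    simp only [mem_product, mem_powerset] at h
    obtain ⟨hB, hC⟩ := h
    ext v
    · simp only [mem_inter, mem_union]
      constructor
      · rintro ⟨h | h, h'⟩
        · exact h
        · have := hC h; simp at this; exact absurd h' this
      · intro h; exact ⟨Or.inl h, hB h⟩
    · simp only [mem_inter, mem_union, mem_compl]
      constructor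
      · rintro ⟨h | h, h'⟩
        · exact absurd (hB h) h'
        · exact h
      · intro h; exact ⟨Or.inr h, by simpa using hC h⟩
  · intro A _
    ext v; simp; tauto
  · rintro ⟨B, C⟩ h
    simp only [mem_product, mem_powerset] at h
    obtain ⟨hB, hC⟩ := h
    have hd : Disjoint B C := by
      rw [Finset.disjoint_left]
      intro v hv hv'
      have := hC hv'; simp at this; exact this (hB hv)
    have hc : (B ∪ C).card = B.card + C.card := card_union_of_disjoint hd
    have h1 : B.card ≤ S.card := card_le_card hB
    have h2 : C.card ≤ (Sᶜ).card := card_le_card hC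
    have h3 : S.card + (Sᶜ).card = (univ : Finset V).card := by
      rw [Finset.card_add_card_compl]; simp
    have h4 : (univ : Finset V).card - (B ∪ C).card = (S.card - B.card) + ((Sᶜ).card - C.card) := by
      omega
    simp only [wt]
    rw [h4, hc, pow_add, pow_add]; ring

lemma Ex_dep (p : ℝ) (S : Finset V) (f : Finset V → ℝ) (hf : Dep S f) :
    Ex p f = ∑ B ∈ S.powerset, wt p S B * f B := by
  rw [Ex_split p S]
  refine sum_congr rfl fun B hB => ?_
  have : ∀ C ∈ (Sᶜ).powerset, wt p S B * wt p Sᶜ C * f (B ∪ C) = wt p S B * f B * wt p Sᶜ C := by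
    intro C hC
    have : f (B ∪ C) = f B := by
      apply hf
      ext v
      simp only [mem_inter, mem_union, mem_powerset] at *
      constructor
      · rintro ⟨h | h, h'⟩
        · exact ⟨h, h'⟩
        · have := hC h; simp at this; exact absurd h' this
      · rintro ⟨h, h'⟩; exact ⟨Or.inl h, h'⟩
    rw [this]; ring
  rw [sum_congr rfl this, ← mul_sum, sum_wt, mul_one]

lemma Dep.mono {β : Type} {S T : Finset V} {f : Finset V → β} (h : Dep S f) (hST : S ⊆ T) :
    Dep T f := by
  intro A B hAB
  apply h
  have : S = T ∩ S := by rw [inter_eq_right.mpr hST]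
  rw [this, ← inter_assoc, ← inter_assoc, hAB]

lemma Ex_mul (p : ℝ) {S T : Finset V} {f g : Finset V → ℝ} (hf : Dep S f) (hg : Dep T g)
    (hST : Disjoint S T) : Ex p (fun A => f A * g A) = Ex p f * Ex p g := by
  have hg' : Dep Sᶜ g := hg.mono (by
    intro v hv; simp; exact fun h => (Finset.disjoint_left.mp hST) h hv)
  rw [Ex_dep p S f hf, Ex_dep p Sᶜ g hg', Ex_split p S, sum_mul_sum]
  refine sum_congr rfl fun B hB => sum_congr rfl fun C hC => ?_
  simp only [mem_powerset] at hB hC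
  have h1 : f (B ∪ C) = f B := by
    apply hf
    ext v
    simp only [mem_inter, mem_union]
    constructor
    · rintro ⟨h | h, h'⟩
      · exact ⟨h, h'⟩
      · have := hC h; simp at this; exact absurd h' this
    · rintro ⟨h, h'⟩; exact ⟨Or.inl h, h'⟩
  have h2 : g (B ∪ C) = g C := by
    apply hg'
    ext v
    simp only [mem_inter, mem_union, mem_compl]
    constructor
    · rintro ⟨h | h, h'⟩
      · exact absurd (hB h) h'
      · exact ⟨h, h'⟩
    · rintro ⟨h, h'⟩; exact ⟨Or.inr h, h'⟩
  rw [h1, h2]; ring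

lemma Pr_nonneg {p : ℝ} (h0 : 0 ≤ p) (h1 : p ≤ 1) (E : Finset V → Prop) : 0 ≤ Pr p E := by
  rw [← Ex_const (V := V) p 0]
  exact Ex_mono h0 h1 fun A => ind_nonneg _

lemma Pr_mono {p : ℝ} (h0 : 0 ≤ p) (h1 : p ≤ 1) {E F : Finset V → Prop} (h : ∀ A, E A → F A) :
    Pr p E ≤ Pr p F :=
  Ex_mono h0 h1 fun A => by
    by_cases hE : E A
    · rw [ind_pos hE, ind_pos (h A hE)]
    · rw [ind_neg hE]; exact ind_nonneg _

lemma Pr_or {p : ℝ} (h0 : 0 ≤ p) (h1 : p ≤ 1) (E F : Finset V → Prop) :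
    Pr p (fun A => E A ∨ F A) ≤ Pr p E + Pr p F := by
  unfold Pr
  rw [← Ex_add]
  exact Ex_mono h0 h1 fun A => by by_cases hE : E A <;> by_cases hF : F A <;> simp [ind, hE, hF]

lemma Pr_exists {ι : Type*} {p : ℝ} (h0 : 0 ≤ p) (h1 : p ≤ 1) (I : Finset ι)
    (E : ι → Finset V → Prop) :
    Pr p (fun A => ∃ i ∈ I, E i A) ≤ ∑ i ∈ I, Pr p (E i) := by
  unfold Pr
  rw [← Ex_sum]
  refine Ex_mono h0 h1 fun A => ?_
  by_cases h : ∃ i ∈ I, E i A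
  · obtain ⟨i, hi, hE⟩ := h
    rw [ind_pos ⟨i, hi, hE⟩]
    calc (1 : ℝ) = ind (E i A) := (ind_pos hE).symm
      _ ≤ _ := single_le_sum (f := fun i => ind (E i A)) (fun j _ => ind_nonneg _) hi
  · rw [ind_neg h]
    exact sum_nonneg fun j _ => ind_nonneg _

lemma Pr_compl (p : ℝ) (E : Finset V → Prop) : Pr p (fun A => ¬ E A) = 1 - Pr p E := by
  have : Pr p (fun A => ¬ E A) + Pr p E = 1 := by
    unfold Pr
    rw [← Ex_add]
    conv_rhs => rw [← Ex_const (V := V) p 1]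
    congr 1; funext A; by_cases h : E A <;> simp [ind, h]
  linarith

lemma Dep_ind {S : Finset V} {E : Finset V → Prop} (h : Dep S E) :
    Dep S (fun A => ind (E A)) := by
  intro A B hAB
  simp only [h A B hAB]

lemma Pr_and (p : ℝ) {S T : Finset V} {E F : Finset V → Prop} (hE : Dep S E) (hF : Dep T F)
    (hST : Disjoint S T) : Pr p (fun A => E A ∧ F A) = Pr p E * Pr p F := by
  unfold Pr
  rw [← Ex_mul p (Dep_ind hE) (Dep_ind hF) hST]
  congr 1; funext A; by_cases h : E A <;> simp [ind, h]

lemma Pr_markov {p : ℝ} (h0 : 0 ≤ p) (h1 : p ≤ 1) {f : Finset V → ℝ} (hf : ∀ A, 0 ≤ f A)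
    {a : ℝ} (ha : 0 < a) : Pr p (fun A => a ≤ f A) ≤ Ex p f / a := by
  rw [le_div_iff₀ ha, mul_comm]
  unfold Pr
  rw [← Ex_smul]
  refine Ex_mono h0 h1 fun A => ?_
  by_cases h : a ≤ f A
  · rw [ind_pos h]; simpa using h
  · rw [ind_neg h]; simpa using hf A

lemma Pr_chebyshev {ι : Type*} {p : ℝ} (h0 : 0 ≤ p) (h1 : p ≤ 1) (I : Finset ι)
    (E : ι → Finset V → Prop) [∀ A i, Decidable (E i A)]
    (hind : ∀ i ∈ I, ∀ j ∈ I, i ≠ j → Pr p (fun A => E i A ∧ E j A) = Pr p (E i) * Pr p (E j))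
    {a : ℝ} (ha : 0 < a) :
    Pr p (fun A => ((I.filter (fun i => E i A)).card : ℝ) ≤ ∑ i ∈ I, Pr p (E i) - a)
      ≤ (∑ i ∈ I, Pr p (E i)) / a ^ 2 := by
  set μ := ∑ i ∈ I, Pr p (E i) with hμ
  let X : Finset V → ℝ := fun A => ∑ i ∈ I, ind (E i A)
  have hX : ∀ A, ((I.filter (fun i => E i A)).card : ℝ) = X A := by
    intro A; exact (sum_ind _ _).symm
  have hEX : Ex p X = μ := by
    simp only [X]; rw [Ex_sum]; rfl
  have hEX2 : Ex p (fun A => X A * X A) ≤ μ + μ * μ := by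
    have : (fun A => X A * X A) = fun A => ∑ i ∈ I, ∑ j ∈ I,
        ind (E i A ∧ E j A) := by
      funext A
      simp only [X, sum_mul_sum]
      refine sum_congr rfl fun i _ => sum_congr rfl fun j _ => ?_
      by_cases h : E i A <;> simp [ind, h]
    rw [this, Ex_sum]
    simp only [Ex_sum]
    have h3 : μ + μ * μ = ∑ i ∈ I, ∑ j ∈ I,
        ((if i = j then Pr p (E i) else 0) + Pr p (E i) * Pr p (E j)) := by
      simp only [sum_add_distrib]
      rw [hμ, sum_mul_sum]
      congr 1
      exact sum_congr rfl fun i hi => by simp [hi]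
    rw [h3]
    refine sum_le_sum fun i hi => sum_le_sum fun j hj => ?_
    by_cases hij : i = j
    · subst hij
      simp only [if_true, and_self]
      have := mul_self_nonneg (Pr p (E i))
      have h5 : Ex p (fun A => ind (E i A)) = Pr p (E i) := rfl
      linarith
    · have := hind i hi j hj hij
      simp only [hij, if_false, zero_add]
      exact this.le
  have hvar : Ex p (fun A => (X A - μ) ^ 2) ≤ μ := by
    have : (fun A => (X A - μ) ^ 2) = fun A => X A * X A + ((-2 * μ) * X A + μ ^ 2) := by
      funext A; ring
    rw [this, Ex_add, Ex_add (f := fun A => (-2 * μ) * X A), Ex_smul, Ex_const, hEX]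
    nlinarith
  calc _ ≤ Pr p (fun A => a ^ 2 ≤ (X A - μ) ^ 2) := by
        refine Pr_mono h0 h1 fun A h => ?_
        rw [hX] at h
        nlinarith
    _ ≤ Ex p (fun A => (X A - μ) ^ 2) / a ^ 2 :=
        Pr_markov h0 h1 (fun A => sq_nonneg _) (by positivity)
    _ ≤ _ := by gcongr

lemma Pr_binom (p : ℝ) (W : Finset V) (k : ℕ) :
    Pr p (fun A => (A ∩ W).card = k) = (W.card.choose k : ℝ) * p ^ k * (1 - p) ^ (W.card - k) := by
  unfold Pr
  rw [Ex_dep p W]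
  · have : ∀ B ∈ W.powerset, wt p W B * ind ((B ∩ W).card = k) =
        if B.card = k then p ^ k * (1 - p) ^ (W.card - k) else 0 := by
      intro B hB
      rw [inter_eq_left.mpr (mem_powerset.mp hB)]
      unfold wt ind
      split_ifs with h
      · rw [h]; ring
      · ring
    rw [sum_congr rfl this, ← sum_filter, sum_const, ← powersetCard_eq_filter, card_powersetCard]
    simp [mul_assoc]
  · exact Dep_ind (fun A B h => by rw [h])

lemma Pr_mem (p : ℝ) (v : V) : Pr p (fun A => v ∈ A) = p := by
  have h := Pr_binom p ({v} : Finset V) 1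
  simp at h
  rw [← h]
  congr 1; funext A
  by_cases hv : v ∈ A
  · simp [inter_singleton_of_mem hv, hv]
  · simp [inter_singleton_of_notMem hv, hv]

lemma Dep_mem (v : V) : Dep {v} (fun A : Finset V => v ∈ A) := by
  intro A B h
  have : v ∈ A ∩ {v} ↔ v ∈ B ∩ {v} := by rw [h]
  simpa using this

/-- all events of `T` occur: product bound -/
lemma Pr_forall {ι : Type*} {p : ℝ} (h0 : 0 ≤ p) (h1 : p ≤ 1) (T : Finset ι)
    (E : ι → Finset V → Prop) (S : ι → Finset V) (hE : ∀ i, Dep (S i) (E i))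
    (hS : ∀ i ∈ T, ∀ j ∈ T, i ≠ j → Disjoint (S i) (S j)) {q : ℝ} (hq : ∀ i ∈ T, Pr p (E i) ≤ q) :
    Pr p (fun A => ∀ i ∈ T, E i A) ≤ q ^ T.card := by
  induction T using Finset.induction_on with
  | empty => simp [Pr, ind, Ex_const]
  | insert i T hi ih =>
    have h2 : Dep (T.biUnion S) (fun A => ∀ i ∈ T, E i A) := by
      intro A B hAB
      have : ∀ j ∈ T, E j A = E j B := fun j hj =>
        ((hE j).mono (subset_biUnion_of_mem S hj)) A B hAB
      simp only [eq_iff_iff]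
      exact forall₂_congr fun j hj => by rw [this j hj]
    have h3 : Disjoint (S i) (T.biUnion S) := by
      rw [disjoint_biUnion_right]
      intro j hj
      exact hS i (mem_insert_self _ _) j (mem_insert_of_mem hj) (by rintro rfl; exact hi hj)
    have h4 : (fun A => ∀ j ∈ insert i T, E j A) = fun A => E i A ∧ ∀ j ∈ T, E j A := by
      funext A; simp
    rw [h4, Pr_and p (hE i) h2 h3, card_insert_of_notMem hi, pow_succ, mul_comm]
    have hq0 : 0 ≤ q := (Pr_nonneg h0 h1 _).trans (hq i (mem_insert_self _ _))
    refine mul_le_mul (ih ?_ ?_) (hq i (mem_insert_self _ _)) (Pr_nonneg h0 h1 _) (by positivity)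
    · exact fun i hi j hj => hS i (mem_insert_of_mem hi) j (mem_insert_of_mem hj)
    · exact fun i hi => hq i (mem_insert_of_mem hi)

/-- many bad events in a family of independent ones -/
lemma Pr_many {ι : Type*} {p : ℝ} (h0 : 0 ≤ p) (h1 : p ≤ 1) (C : Finset ι)
    (E : ι → Finset V → Prop) [∀ A i, Decidable (E i A)] (S : ι → Finset V)
    (hE : ∀ i, Dep (S i) (E i))
    (hS : ∀ i ∈ C, ∀ j ∈ C, i ≠ j → Disjoint (S i) (S j)) {q : ℝ} (hq0 : 0 ≤ q) (hq1 : q ≤ 1)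
    (hq : ∀ i ∈ C, Pr p (E i) ≤ q) (k : ℕ) :
    Pr p (fun A => k ≤ (C.filter (fun i => E i A)).card) ≤ 2 ^ C.card * q ^ k := by
  calc _ ≤ Pr p (fun A => ∃ T ∈ C.powerset.filter (fun T => k ≤ T.card), ∀ i ∈ T, E i A) := by
        refine Pr_mono h0 h1 fun A h => ⟨C.filter (fun i => E i A), ?_, ?_⟩
        · simp [h]
        · intro i hi; exact (mem_filter.mp hi).2
    _ ≤ ∑ T ∈ C.powerset.filter (fun T => k ≤ T.card), Pr p (fun A => ∀ i ∈ T, E i A) :=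
        Pr_exists h0 h1 _ _
    _ ≤ ∑ T ∈ C.powerset.filter (fun T => k ≤ T.card), q ^ k := by
        refine sum_le_sum fun T hT => ?_
        simp only [mem_filter, mem_powerset] at hT
        refine (Pr_forall h0 h1 T E S hE (fun i hi j hj => hS i (hT.1 hi) j (hT.1 hj))
          (fun i hi => hq i (hT.1 hi))).trans ?_
        exact pow_le_pow_of_le_one hq0 hq1 hT.2
    _ ≤ ∑ T ∈ C.powerset, q ^ k :=
        sum_le_sum_of_subset_of_nonneg (filter_subset _ _) (fun _ _ _ => by positivity)
    _ = _ := by simp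

/-- link with `prob` -/
lemma prob_eq_Pr (p : ℝ) (E : Set V → Prop) :
    prob p E = Pr p (fun A : Finset V => E (A : Set V)) := by
  unfold prob Pr Ex
  rw [finsum_mem_eq_finite_toFinset_sum _ (Set.toFinite _)]
  have : (Set.toFinite {A : Set V | E A}).toFinset = univ.filter E := by
    ext A; simp
  rw [this, sum_filter]
  symm
  refine Fintype.sum_equiv Fintype.finsetEquivSet _ _ fun A => ?_
  simp only [Fintype.finsetEquivSet_apply]
  have h1 : weight p (A : Set V) = wt p univ A := by
    unfold weight wt
    rw [Set.ncard_coe_finset, ← Finset.coe_compl, Set.ncard_coe_finset, card_compl, card_univ]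
  rw [h1]
  by_cases h : E A <;> simp [ind, h]

end Framework

/-! ### Binomial tail estimate -/

section Tail

open Classical Finset

lemma central_lower (n : ℕ) (hn : 1 ≤ n) : 16 ^ n ≤ 4 * n * (Nat.centralBinom n) ^ 2 := by
  induction n, hn using Nat.le_induction with
  | base => decide
  | succ n hn ih =>
    have h := Nat.succ_mul_centralBinom_succ n
    have h1 : (n + 1) * (4 * (n + 1) * (Nat.centralBinom (n + 1)) ^ 2) =
        4 * (2 * (2 * n + 1) * Nat.centralBinom n) ^ 2 := by rw [← h]; ring
    have h2 : (n + 1) * 16 ^ (n + 1) ≤ (n + 1) * (4 * (n + 1) * (Nat.centralBinom (n + 1)) ^ 2) := by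
      rw [h1, pow_succ]
      calc (n + 1) * (16 ^ n * 16) ≤ (n + 1) * (4 * n * (Nat.centralBinom n) ^ 2 * 16) := by gcongr
        _ = (4 * n * (n + 1)) * (16 * (Nat.centralBinom n) ^ 2) := by ring
        _ ≤ ((2 * n + 1) ^ 2) * (16 * (Nat.centralBinom n) ^ 2) := by
            gcongr; nlinarith
        _ = _ := by ring
    exact Nat.le_of_mul_le_mul_left h2 (Nat.succ_pos n)

lemma central_lower' (n : ℕ) (hn : 1 ≤ n) : (4 : ℝ) ^ n / (2 * √n) ≤ Nat.centralBinom n := by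
  have hn' : (0 : ℝ) < n := by exact_mod_cast hn
  have h : (16 : ℝ) ^ n ≤ 4 * n * (Nat.centralBinom n : ℝ) ^ 2 := by
    exact_mod_cast central_lower n hn
  have hs : 0 < √(n : ℝ) := Real.sqrt_pos.mpr hn'
  rw [div_le_iff₀ (by positivity)]
  apply le_of_sq_le_sq _ (by positivity)
  calc ((4 : ℝ) ^ n) ^ 2 = 16 ^ n := by rw [← pow_mul, mul_comm, pow_mul]; norm_num
    _ ≤ _ := h
    _ = _ := by rw [mul_pow, mul_pow, Real.sq_sqrt hn'.le]; ring

lemma choose_lower (n j : ℕ) (hn : 1 ≤ n) (hj : j ≤ n) :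
    (Nat.centralBinom n : ℝ) * (1 - (j : ℝ) ^ 2 / n) ≤ ((2 * n).choose (n + j) : ℝ) := by
  have hn' : (0 : ℝ) < n := by exact_mod_cast hn
  induction j with
  | zero => simp [Nat.centralBinom]
  | succ j ih =>
    have ih := ih (by omega)
    have h := Nat.choose_succ_right_eq (2 * n) (n + j)
    have h1 : 2 * n - (n + j) = n - j := by omega
    rw [h1] at h
    have h2 : ((2 * n).choose (n + j + 1) : ℝ) * (n + j + 1) =
        ((2 * n).choose (n + j) : ℝ) * (n - j) := by
      have := congrArg (Nat.cast (R := ℝ)) h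
      push_cast [Nat.cast_sub (show j ≤ n by omega)] at this
      exact this
    have h3 : ((2 * n).choose (n + j) : ℝ) ≤ Nat.centralBinom n := by
      exact_mod_cast Nat.choose_le_centralBinom (n + j) n
    set c := ((2 * n).choose (n + j) : ℝ)
    set C := (Nat.centralBinom n : ℝ)
    have hc : 0 ≤ c := Nat.cast_nonneg _
    have h4 : ((2 * n).choose (n + j + 1) : ℝ) = c - c * (2 * j + 1) / (n + j + 1) := by
      field_simp
      linarith
    have h5 : c * (2 * j + 1) / (n + j + 1) ≤ C * (2 * j + 1) / n := by
      gcongr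
      linarith [(Nat.cast_nonneg j : (0 : ℝ) ≤ j)]
    rw [← add_assoc, h4]
    push_cast
    have h6 : C * (1 - ((j : ℝ) + 1) ^ 2 / n) = C * (1 - (j : ℝ) ^ 2 / n) - C * (2 * j + 1) / n := by
      field_simp; ring
    rw [h6]
    linarith

lemma pmf_lower (n s j : ℕ) (hn : 1 ≤ n) (hs : 8 * s ^ 2 ≤ n) (hj : j ≤ 2 * s) (hjn : j ≤ n)
    {p b : ℝ} (hb : b ≤ 1 / 4) (hp1 : 1 / 2 - b ≤ p) (hp2 : p ≤ 1 / 2 + b) :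
    (1 / (4 * √n)) * ((1 - 4 * b ^ 2) ^ n * (1 - 2 * b) ^ (4 * s)) ≤
      ((2 * n).choose (n + j) : ℝ) * p ^ (n + j) * (1 - p) ^ (2 * n - (n + j)) := by
  have hn' : (0 : ℝ) < n := by exact_mod_cast hn
  have hb0 : 0 ≤ b := by linarith
  have hsq : 0 < √(n : ℝ) := Real.sqrt_pos.mpr hn'
  have h1 : (4 : ℝ) ^ n / (2 * √n) * (1 / 2) ≤ ((2 * n).choose (n + j) : ℝ) := by
    refine le_trans ?_ (choose_lower n j hn hjn)
    refine mul_le_mul (central_lower' n hn) ?_ (by norm_num) (Nat.cast_nonneg _)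
    have : (j : ℝ) ^ 2 / n ≤ 1 / 2 := by
      rw [div_le_iff₀ hn']
      have h3 : 8 * (s : ℝ) ^ 2 ≤ n := by exact_mod_cast hs
      have h4 : (j : ℝ) ≤ 2 * s := by exact_mod_cast hj
      have h5 : (0 : ℝ) ≤ j := Nat.cast_nonneg _
      nlinarith
    linarith
  have h2 : (1 / 4 : ℝ) ^ n * ((1 - 4 * b ^ 2) ^ n * (1 - 2 * b) ^ (4 * s)) ≤
      p ^ (n + j) * (1 - p) ^ (2 * n - (n + j)) := by
    have e1 : 2 * n - (n + j) = n - j := by omega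
    have e2 : n + j = (n - j) + 2 * j := by omega
    rw [e1, e2, pow_add, mul_right_comm, ← mul_pow]
    have hA : (1 / 4 * (1 - 4 * b ^ 2)) ^ (n - j) ≤ (p * (1 - p)) ^ (n - j) := by
      apply pow_le_pow_left₀
      · nlinarith
      · nlinarith
    have hB : (1 / 4 * (1 - 2 * b) ^ 2) ^ j ≤ p ^ (2 * j) := by
      rw [pow_mul]
      apply pow_le_pow_left₀
      · positivity
      · nlinarith
    refine le_trans ?_ (mul_le_mul hA hB (by positivity) (by
      apply pow_nonneg; nlinarith))
    rw [mul_pow, mul_pow]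
    have hC : (1 - 4 * b ^ 2) ^ n ≤ (1 - 4 * b ^ 2) ^ (n - j) :=
      pow_le_pow_of_le_one (by nlinarith) (by nlinarith) (by omega)
    have hD : (1 - 2 * b) ^ (4 * s) ≤ (1 - 2 * b) ^ (2 * j) :=
      pow_le_pow_of_le_one (by linarith) (by linarith) (by omega)
    have hE : (1 / 4 : ℝ) ^ n = (1 / 4) ^ (n - j) * (1 / 4) ^ j := by
      rw [← pow_add]; congr 1; omega
    rw [hE, ← pow_mul]
    have h0 : 0 ≤ (1 - 4 * b ^ 2) ^ n := by apply pow_nonneg; nlinarith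
    have h0' : 0 ≤ (1 - 2 * b) ^ (4 * s) := by apply pow_nonneg; linarith
    calc _ ≤ (1 / 4 : ℝ) ^ (n - j) * (1 / 4) ^ j *
          ((1 - 4 * b ^ 2) ^ (n - j) * (1 - 2 * b) ^ (2 * j)) := by
          gcongr
          exact h0.trans hC
      _ = _ := by ring
  have h0 : 0 ≤ (1 - 4 * b ^ 2) ^ n := by apply pow_nonneg; nlinarith
  have h0' : 0 ≤ (1 - 2 * b) ^ (4 * s) := by apply pow_nonneg; linarith
  rw [mul_assoc]
  refine le_trans (le_of_eq ?_) (mul_le_mul h1 h2 (by positivity) (Nat.cast_nonneg _))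
  have : (4 : ℝ) ^ n * (1 / 4) ^ n = 1 := by rw [← mul_pow]; norm_num
  calc _ = (1 / (4 * √n)) * ((1 - 4 * b ^ 2) ^ n * (1 - 2 * b) ^ (4 * s)) *
        ((4 : ℝ) ^ n * (1 / 4) ^ n) := by rw [this, mul_one]
    _ = _ := by field_simp; ring

variable {V : Type} [Fintype V]

lemma tail_lower (n s : ℕ) (hn : 1 ≤ n) (hs : 8 * s ^ 2 ≤ n)
    {p b T : ℝ} (h0 : 0 ≤ p) (h1 : p ≤ 1) (hb : b ≤ 1 / 4) (hp1 : 1 / 2 - b ≤ p)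
    (hp2 : p ≤ 1 / 2 + b) (W : Finset V) (hW : W.card = 2 * n) (hT : T ≤ n + s) :
    (s / (4 * √n)) * ((1 - 4 * b ^ 2) ^ n * (1 - 2 * b) ^ (4 * s)) ≤
      Pr p (fun A => T ≤ ((A ∩ W).card : ℝ)) := by
  calc _ = ∑ j ∈ range s, (1 / (4 * √n)) * ((1 - 4 * b ^ 2) ^ n * (1 - 2 * b) ^ (4 * s)) := by
        rw [sum_const, card_range, nsmul_eq_mul]; ring
    _ ≤ ∑ j ∈ range s, Pr p (fun A => (A ∩ W).card = n + (s + j)) := by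
        refine sum_le_sum fun j hj => ?_
        rw [mem_range] at hj
        rw [Pr_binom, hW]
        exact pmf_lower n s (s + j) hn hs (by omega) (by nlinarith) hb hp1 hp2
    _ = Ex p (fun A => ∑ j ∈ range s, ind ((A ∩ W).card = n + (s + j))) := by
        rw [Ex_sum]; rfl
    _ ≤ _ := by
        refine Ex_mono h0 h1 fun A => ?_
        by_cases h : T ≤ ((A ∩ W).card : ℝ)
        · rw [ind_pos h]
          have : ∑ j ∈ range s, ind ((A ∩ W).card = n + (s + j)) =
              (((range s).filter (fun j => (A ∩ W).card = n + (s + j))).card : ℝ) := sum_ind _ _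
          rw [this]
          norm_cast
          rw [card_le_one]
          intro a ha c hc
          simp at ha hc
          omega
        · rw [ind_neg h]
          apply le_of_eq
          apply sum_eq_zero
          intro j _
          apply ind_neg
          intro h'
          apply h
          rw [h']
          push_cast
          have : (0 : ℝ) ≤ j := Nat.cast_nonneg _
          linarith

end Tail

/-! ### Asymptotics -/

section Asymp

lemma one_sub_ge_exp {x : ℝ} (hx1 : x < 1) : Real.exp (-(x / (1 - x))) ≤ 1 - x := by
  have h := Real.add_one_le_exp (x / (1 - x))
  have h1 : 0 < 1 - x := by linarith
  have h2 : x / (1 - x) + 1 = (1 - x)⁻¹ := by field_simp; ring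
  rw [h2] at h
  rw [Real.exp_neg]
  exact inv_le_of_inv_le₀ h1 h

set_option maxHeartbeats 1000000 in
lemma analytic (K : ℕ) (ε : ℝ) (hε : 0 < ε) (hε4 : ε ≤ 1 / 4) (η : ℝ) (hη : 0 < η) :
    ∃ d0 : ℕ, ∀ d : ℕ, d0 ≤ d → ∃ (s n : ℕ) (b q : ℝ),
      b = (1 / 2 - ε) * √(Real.log d / d) ∧ 0 < b ∧ b ≤ 1 / 4 ∧
      1 / (d * b ^ 2) ≤ η ∧ 0 < q ∧ 8 / (s * q) ≤ η ∧ 16 * b ≤ q ∧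
      q ≤ (1 / 4) * ((s / (4 * √n)) * ((1 - 4 * b ^ 2) ^ n * (1 - 2 * b) ^ (4 * s))) ∧
      1 ≤ n ∧ 8 * s ^ 2 ≤ n ∧ 4 * K + 1 ≤ s ∧ 2 * n + 3 * K + s ≤ d ∧ d ≤ 2 * n + 3 * K + s + 1 ∧
      2 * s + 2 ≤ d := by
  have hcast : Tendsto (fun d : ℕ => (d : ℝ)) atTop atTop := tendsto_natCast_atTop_atTop
  have hL : Tendsto (fun d : ℕ => Real.log d) atTop atTop := Real.tendsto_log_atTop.comp hcast
  have hsq : Tendsto (fun d : ℕ => √(d : ℝ)) atTop atTop := Real.tendsto_sqrt_atTop.comp hcast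
  have hLd : Tendsto (fun d : ℕ => Real.log d / d) atTop (nhds 0) := by
    have := (Real.isLittleO_log_id_atTop).tendsto_div_nhds_zero
    exact this.comp hcast
  have hexp : Tendsto (fun d : ℕ => Real.exp (ε * Real.log d / 2) / (ε * Real.log d / 2)) atTop
      atTop := by
    have h1 := Real.tendsto_exp_div_pow_atTop 1
    simp only [pow_one] at h1
    have h2 : Tendsto (fun d : ℕ => ε * Real.log d / 2) atTop atTop := by
      have := (hL.const_mul_atTop (show 0 < ε / 2 by positivity))
      refine this.congr fun d => by ring
    exact h1.comp h2
  have hexp' : Tendsto (fun d : ℕ => Real.exp (ε * Real.log d / 2)) atTop atTop := by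
    apply Real.tendsto_exp_atTop.comp
    have := (hL.const_mul_atTop (show 0 < ε / 2 by positivity))
    refine this.congr fun d => by ring
  have ev : ∀ᶠ d : ℕ in atTop,
      (4096 / ε ≤ Real.exp (ε * Real.log d / 2) / (ε * Real.log d / 2)) ∧
      (32768 / η ≤ Real.exp (ε * Real.log d / 2)) ∧
      (max 1 (max (4 / ε ^ 2) (16 / η)) ≤ Real.log d) ∧
      (Real.log d / d ≤ ε / 4) ∧ (max (1000 : ℝ) (128 * ((K : ℝ) + 1)) ≤ √(d : ℝ)) :=
    (hexp.eventually_ge_atTop _).and ((hexp'.eventually_ge_atTop _).and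
      ((hL.eventually_ge_atTop _).and
      ((hLd.eventually_le_const (by positivity)).and (hsq.eventually_ge_atTop _))))
  obtain ⟨d0, hd0⟩ := eventually_atTop.mp ev
  refine ⟨d0, fun d hd => ?_⟩
  obtain ⟨e1, e2, e3, e4, e5⟩ := hd0 d hd
  clear ev hd0 hcast hL hsq hLd hexp hexp'
  set L := Real.log d with hLdef
  have hL1 : 1 ≤ L := (le_max_left _ _).trans e3
  have hL2 : 4 / ε ^ 2 ≤ L := (le_max_left _ _).trans ((le_max_right _ _).trans e3)
  have hL3 : 16 / η ≤ L := (le_max_right _ _).trans ((le_max_right _ _).trans e3)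
  have hr1 : 1000 ≤ √(d : ℝ) := (le_max_left _ _).trans e5
  have hr2 : 128 * ((K : ℝ) + 1) ≤ √(d : ℝ) := (le_max_right _ _).trans e5
  set r := √(d : ℝ) with hr
  have hrr : r ^ 2 = d := Real.sq_sqrt (Nat.cast_nonneg d)
  have hdpos : (0 : ℝ) < d := by rw [← hrr]; positivity
  have hr3 : 1000 * r ≤ r ^ 2 := by nlinarith only [hr1]
  have hK0 : (0 : ℝ) ≤ K := Nat.cast_nonneg K
  -- s
  obtain ⟨s, hs1, hs2⟩ : ∃ s : ℕ, (s : ℝ) ≤ r / 8 ∧ r / 16 ≤ s := by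
    refine ⟨⌊r / 8⌋₊, Nat.floor_le (by positivity), ?_⟩
    have := Nat.lt_floor_add_one (r / 8)
    linarith
  have hsK : 4 * K + 1 ≤ s := by
    have : (4 * K + 1 : ℝ) ≤ s := by linarith [(Nat.cast_nonneg K : (0 : ℝ) ≤ K)]
    exact_mod_cast this
  have hsd : 3 * K + s + 2 ≤ d := by
    have : (3 * K + s + 2 : ℝ) ≤ d := by rw [← hrr]; linarith
    exact_mod_cast this
  have hsd2 : 2 * s + 2 ≤ d := by
    have : (2 * s + 2 : ℝ) ≤ d := by rw [← hrr]; linarith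
    exact_mod_cast this
  obtain ⟨n, hn1, hn2⟩ : ∃ n : ℕ, 2 * n + 3 * K + s ≤ d ∧ d ≤ 2 * n + 3 * K + s + 1 :=
    ⟨(d - 3 * K - s) / 2, by omega, by omega⟩
  have hn3 : 1 ≤ n := by omega
  have hn1' : 2 * (n : ℝ) ≤ d := by
    have : 2 * n ≤ d := by omega
    exact_mod_cast this
  have hn2' : (d : ℝ) ≤ 2 * n + 3 * K + s + 1 := by exact_mod_cast hn2
  have h8s : 8 * s ^ 2 ≤ n := by
    have : 8 * (s : ℝ) ^ 2 ≤ n := by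
      have h1 : 8 * (s : ℝ) ^ 2 ≤ r ^ 2 / 8 := by
        nlinarith only [hs1, (Nat.cast_nonneg s : (0 : ℝ) ≤ s)]
      have h2 : 3 * (K : ℝ) + s + 1 ≤ r ^ 2 / 2 := by linarith
      linarith
    exact_mod_cast this
  have hnpos : (0 : ℝ) < n := by exact_mod_cast hn3
  -- b
  set u := √L with hu
  have huu : u ^ 2 = L := Real.sq_sqrt (by linarith)
  have hu1 : 1 ≤ u := by rw [hu]; exact Real.one_le_sqrt.mpr hL1
  have hb_eq : √(L / d) = u / r := Real.sqrt_div (by linarith) _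
  have hrpos : 0 < r := by linarith
  have hεh : 0 < 1 / 2 - ε := by linarith
  set b := (1 / 2 - ε) * √(L / d) with hb
  have hb' : b = (1 / 2 - ε) * (u / r) := by rw [hb, hb_eq]
  have hbpos : 0 < b := by rw [hb']; positivity
  have hur : (u / r) ^ 2 = L / d := by rw [div_pow, huu, hrr]
  have hb2 : b ^ 2 = (1 / 2 - ε) ^ 2 * (L / d) := by rw [hb', mul_pow, hur]
  have hdb2 : d * b ^ 2 = (1 / 2 - ε) ^ 2 * L := by rw [hb2]; field_simp
  have hb2s : 4 * b ^ 2 ≤ ε / 4 := by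
    rw [hb2]
    have h1 : (1 / 2 - ε) ^ 2 ≤ 1 / 4 := by nlinarith only [hε, hε4]
    have h2 : 0 ≤ L / d := by positivity
    nlinarith only [h1, h2, e4]
  have hb14 : b ≤ 1 / 4 := by nlinarith only [hb2s, hbpos, hε4]
  -- q
  have hexpL : Real.exp (L / 2) = r := by
    have : Real.exp (L / 2) ^ 2 = r ^ 2 := by
      rw [hrr, ← Real.exp_nat_mul]
      push_cast
      rw [show (2 : ℝ) * (L / 2) = L by ring, hLdef, Real.exp_log hdpos]
    exact (pow_left_inj₀ (Real.exp_pos _).le hrpos.le two_ne_zero).mp this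
  set X := Real.exp (ε * L / 2) with hX
  have hXpos : 0 < X := Real.exp_pos _
  have hq1 : Real.exp (-(L / 2) + ε * L) ≤ (1 - 4 * b ^ 2) ^ n := by
    have hx1 : 4 * b ^ 2 < 1 := by linarith
    have h := one_sub_ge_exp hx1
    have h2 := pow_le_pow_left₀ (Real.exp_pos _).le h n
    refine le_trans ?_ h2
    rw [← Real.exp_nat_mul]
    apply Real.exp_le_exp.mpr
    have h3 : 4 * b ^ 2 / (1 - 4 * b ^ 2) ≤ (1 + ε) * (4 * b ^ 2) := by
      rw [div_le_iff₀ (by linarith)]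
      have : 0 ≤ 4 * b ^ 2 := by positivity
      have h4 : 1 ≤ (1 + ε) * (1 - 4 * b ^ 2) := by nlinarith only [hb2s, hε, hε4]
      nlinarith only [this, h4]
    have h5 : (n : ℝ) * (4 * b ^ 2 / (1 - 4 * b ^ 2)) ≤ (d / 2) * ((1 + ε) * (4 * b ^ 2)) := by
      apply mul_le_mul (by linarith) h3 _ (by positivity)
      apply div_nonneg (by positivity) (by linarith)
    have h6 : (d / 2 : ℝ) * ((1 + ε) * (4 * b ^ 2)) = 2 * (1 + ε) * ((1 / 2 - ε) ^ 2 * L) := by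
      rw [← hdb2]; ring
    have h7 : 2 * (1 + ε) * (1 / 2 - ε) ^ 2 ≤ 1 / 2 - ε := by
      nlinarith only [hε, hε4, mul_pos hε hε, mul_pos hε (mul_pos hε hε)]
    have h8 : 2 * (1 + ε) * ((1 / 2 - ε) ^ 2 * L) ≤ (1 / 2 - ε) * L := by
      nlinarith only [h7, hL1]
    linarith
  have hq2 : Real.exp (-u) ≤ (1 - 2 * b) ^ (4 * s) := by
    have hx1 : 2 * b < 1 := by linarith
    have h := one_sub_ge_exp hx1
    have h2 := pow_le_pow_left₀ (Real.exp_pos _).le h (4 * s)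
    refine le_trans ?_ h2
    rw [← Real.exp_nat_mul]
    apply Real.exp_le_exp.mpr
    have h3 : 2 * b / (1 - 2 * b) ≤ 4 * b := by
      rw [div_le_iff₀ (by linarith)]
      nlinarith only [hbpos, hb14]
    push_cast
    have h5 : (4 * s : ℝ) * (2 * b / (1 - 2 * b)) ≤ (4 * (r / 8)) * (4 * b) := by
      apply mul_le_mul (by linarith) h3 _ (by positivity)
      apply div_nonneg (by positivity) (by linarith)
    have h6 : (4 * (r / 8)) * (4 * b) = 2 * (1 / 2 - ε) * u := by
      rw [hb']; field_simp; ring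
    have h7 : 2 * (1 / 2 - ε) * u ≤ u := by nlinarith only [hu1, hε, hεh]
    linarith
  have hq3 : Real.exp (-(L / 2)) * X ≤ (1 - 4 * b ^ 2) ^ n * (1 - 2 * b) ^ (4 * s) := by
    refine le_trans ?_ (mul_le_mul hq1 hq2 (Real.exp_pos _).le ?_)
    · rw [hX, ← Real.exp_add, ← Real.exp_add]
      apply Real.exp_le_exp.mpr
      have : u ≤ ε * L / 2 := by
        have h1 : 2 / ε ≤ u := by
          rw [hu]
          apply Real.le_sqrt_of_sq_le
          rw [div_pow]; norm_num; exact hL2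
        have h2 : 2 ≤ u * ε := (div_le_iff₀ hε).mp h1
        rw [← huu]; nlinarith only [h2, hu1]
      linarith
    · apply pow_nonneg; linarith
  have hq4 : 1 / 64 ≤ (s : ℝ) / (4 * √n) := by
    have h1 : √(n : ℝ) ≤ r := Real.sqrt_le_sqrt (by linarith)
    have h2 : 0 < √(n : ℝ) := Real.sqrt_pos.mpr hnpos
    rw [le_div_iff₀ (by positivity)]
    linarith
  refine ⟨s, n, b, (1 / 256) * (Real.exp (-(L / 2)) * X), rfl, hbpos, hb14, ?_, by positivity, ?_,
    ?_, ?_, hn3, h8s, hsK, hn1, hn2, hsd2⟩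
  · rw [hdb2]
    have h1 : (1 / 16 : ℝ) ≤ (1 / 2 - ε) ^ 2 := by nlinarith only [hε, hε4]
    rw [div_le_iff₀ (by positivity)]
    have h2 : 16 ≤ L * η := (div_le_iff₀ hη).mp hL3
    nlinarith only [h1, h2, mul_le_mul_of_nonneg_right h1 (by positivity : 0 ≤ L * η)]
  · have h1 : X / 4096 ≤ s * ((1 / 256) * (Real.exp (-(L / 2)) * X)) := by
      rw [Real.exp_neg, hexpL]
      have : X / 4096 = (r / 16) * ((1 / 256) * (r⁻¹ * X)) := by field_simp; norm_num
      rw [this]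
      gcongr
    have h2 : 32768 ≤ X * η := (div_le_iff₀ hη).mp e2
    rw [div_le_iff₀ (by have := hXpos; linarith)]
    nlinarith only [h1, h2, hη]
  · rw [Real.exp_neg, hexpL, hb']
    have h1 : 4096 / ε * (ε * L / 2) ≤ X := (le_div_iff₀ (by positivity)).mp e1
    have h2 : 4096 / ε * (ε * L / 2) = 2048 * L := by field_simp; norm_num
    rw [h2] at h1
    have h3 : u ≤ L := by rw [← huu]; nlinarith only [hu1]
    have h4 : 16 * ((1 / 2 - ε) * (u / r)) = (16 * (1 / 2 - ε) * u) * r⁻¹ := by field_simp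
    have h5 : 1 / 256 * (r⁻¹ * X) = (X / 256) * r⁻¹ := by ring
    rw [h4, h5]
    apply mul_le_mul_of_nonneg_right _ (by positivity)
    nlinarith only [h1, h3, hu1, hε, hεh]
  · have h := mul_le_mul hq4 hq3 (by positivity) (by positivity)
    linarith

end Asymp

/-! ### The first two rounds -/

section StepA

open Classical Finset

variable {V : Type} [Fintype V]

lemma chunk (Y : Finset V) (s : ℕ) (hs : 1 ≤ s) (r : ℕ) (hr : r * s ≤ Y.card) :
    ∃ P : Finset (Finset V), P.card = r ∧ (∀ g ∈ P, g ⊆ Y ∧ g.card = s) ∧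
      (∀ g ∈ P, ∀ h ∈ P, g ≠ h → Disjoint g h) := by
  induction r with
  | zero => exact ⟨∅, by simp⟩
  | succ r ih =>
    obtain ⟨P, h1, h2, h3⟩ := ih (by nlinarith)
    have hU : (P.biUnion id).card ≤ r * s := by
      rw [← h1]
      exact card_biUnion_le_card_mul _ _ _ fun g hg => (h2 g hg).2.le
    have : s ≤ (Y \ P.biUnion id).card := by
      have := le_card_sdiff (P.biUnion id) Y
      have h4 : (r + 1) * s = r * s + s := by ring
      omega
    obtain ⟨g, hg, hgs⟩ := exists_subset_card_eq this
    have hdis : ∀ h ∈ P, Disjoint g h := by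
      intro h hh
      rw [Finset.disjoint_left]
      intro v hv hv'
      have := hg hv
      exact (mem_sdiff.mp this).2 (mem_biUnion.mpr ⟨h, hh, hv'⟩)
    have hgP : g ∉ P := by
      intro h
      have := hdis g h
      rw [disjoint_self_iff_empty] at this
      rw [this, card_empty] at hgs; omega
    refine ⟨insert g P, by rw [card_insert_of_notMem hgP, h1], ?_, ?_⟩
    · intro h hh
      rcases mem_insert.mp hh with rfl | hh
      · exact ⟨hg.trans sdiff_subset, hgs⟩
      · exact h2 h hh
    · intro a ha c hc hac
      rcases mem_insert.mp ha with ha | ha <;> rcases mem_insert.mp hc with hc | hc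
      · exact absurd (ha.trans hc.symm) hac
      · rw [ha]; exact hdis c hc
      · rw [hc]; exact (hdis a ha).symm
      · exact h3 a ha c hc hac

lemma cheb_nbr {p b : ℝ} (h0 : 0 ≤ p) (h1 : p ≤ 1) (hb : 0 < b) (N : Finset V)
    (hN : 1 ≤ N.card) :
    Pr p (fun A => ((A ∩ N).card : ℝ) ≤ N.card * p - N.card * b) ≤ 1 / (N.card * b ^ 2) := by
  have hd : (0 : ℝ) < N.card := by exact_mod_cast hN
  have h := Pr_chebyshev h0 h1 N (fun v (A : Finset V) => v ∈ A) (by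
    intro i _ j _ hij
    exact Pr_and p (Dep_mem i) (Dep_mem j) (by simpa using hij)) (a := N.card * b) (by positivity)
  simp only [Pr_mem, sum_const, nsmul_eq_mul] at h
  refine le_trans (le_of_eq ?_) (h.trans ?_)
  · congr 1; funext A
    rw [Finset.filter_mem_eq_inter, inter_comm]
  · rw [div_le_div_iff₀ (by positivity) (by positivity)]
    have : (N.card : ℝ) * p * (N.card * b ^ 2) = p * ((N.card : ℝ) * b) ^ 2 := by ring
    rw [this]
    have : 0 ≤ ((N.card : ℝ) * b) ^ 2 := by positivity
    nlinarith

lemma stepA_core {p b q : ℝ} (h0 : 0 ≤ p) (h1 : p ≤ 1) (K s n : ℕ) (N Y : Finset V)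
    (W0 : V → Finset V) (T : V → ℝ) (hYN : Y ⊆ N) (hYc : N.card ≤ Y.card + 1)
    (hWN : ∀ y ∈ Y, Disjoint (W0 y) N)
    (hWc : ∀ y ∈ Y, N.card ≤ (W0 y).card + 3 * K)
    (hWW : ∀ y ∈ Y, ∀ z ∈ Y, y ≠ z → (W0 y ∩ W0 z).card ≤ 1)
    (hT : ∀ y ∈ Y, T y ≤ ((N.card : ℝ) + K) / 2)
    (hb0 : 0 < b) (hb1 : b ≤ 1 / 4) (hq0 : 0 < q) (hqb : 16 * b ≤ q)
    (hq : q ≤ (1 / 4) * ((s / (4 * √n)) * ((1 - 4 * b ^ 2) ^ n * (1 - 2 * b) ^ (4 * s))))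
    (hn : 1 ≤ n) (h8s : 8 * s ^ 2 ≤ n) (hsK : 4 * K + 1 ≤ s) (hn1 : 2 * n + 3 * K + s ≤ N.card)
    (hn2 : N.card ≤ 2 * n + 3 * K + s + 1) (hs2 : 2 * s + 2 ≤ N.card)
    (hp : 1 / 2 - b ≤ p) :
    Pr p (fun A => ((N.filter (fun y => y ∈ A ∨ (y ∈ Y ∧ T y ≤ ((A ∩ W0 y).card : ℝ)))).card : ℝ)
      < (N.card : ℝ) / 2) ≤ 1 / (N.card * b ^ 2) + 8 / (s * q) := by
  have hcheb := cheb_nbr h0 h1 hb0 N (by omega)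
  have hspos : (0 : ℝ) < s := by
    have : 0 < s := by omega
    exact_mod_cast this
  have hsub : ∀ A : Finset V, A ∩ N ⊆
      N.filter (fun y => y ∈ A ∨ (y ∈ Y ∧ T y ≤ ((A ∩ W0 y).card : ℝ))) := by
    intro A v hv
    rw [mem_inter] at hv
    exact mem_filter.mpr ⟨hv.2, Or.inl hv.1⟩
  rcases le_or_gt (1 / 2 + b) p with hpb | hpb
  · have h2 : 0 ≤ 8 / (s * q) := by positivity
    refine le_trans ?_ (hcheb.trans (by linarith))
    refine Pr_mono h0 h1 fun A hA => ?_
    have h3 : ((A ∩ N).card : ℝ) ≤ _ := Nat.cast_le.mpr (card_le_card (hsub A))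
    have h4 : (0 : ℝ) ≤ N.card := Nat.cast_nonneg _
    nlinarith
  -- groups
  have hr : (Y.card / s) * s ≤ Y.card := Nat.div_mul_le_self _ _
  obtain ⟨P, hPc, hP, hPd⟩ := chunk Y s (by omega) _ hr
  have hrs : (N.card : ℝ) / 2 ≤ P.card * s := by
    have h2 : Y.card < (Y.card / s) * s + s := by
      have := Nat.lt_div_mul_add (a := Y.card) (b := s) (by omega)
      omega
    have h3 : N.card ≤ 2 * (P.card * s) := by rw [hPc]; omega
    have h4 : (N.card : ℝ) ≤ 2 * (P.card * s) := by exact_mod_cast h3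
    linarith
  have hPpos : (0 : ℝ) < P.card := by
    by_contra h
    have h2 : (0 : ℝ) < N.card := by
      have : 0 < N.card := by omega
      exact_mod_cast this
    nlinarith
  have hW : ∀ g ∈ P, ∀ y ∈ g, ∃ W : Finset V, W ⊆ W0 y ∧ W.card = 2 * n ∧
      ∀ z ∈ g, z ≠ y → Disjoint W (W0 z) := by
    intro g hg y hy
    have hyY := (hP g hg).1 hy
    have hU : (W0 y ∩ (g.erase y).biUnion W0).card ≤ s := by
      rw [inter_biUnion]
      have : ((g.erase y).biUnion fun z => W0 y ∩ W0 z).card ≤ (g.erase y).card * 1 := by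
        refine card_biUnion_le_card_mul _ _ _ fun z hz => ?_
        rw [mem_erase] at hz
        exact hWW y hyY z ((hP g hg).1 hz.2) (Ne.symm hz.1)
      have h2 := card_erase_le (s := g) (a := y)
      have h3 := (hP g hg).2
      omega
    have hc : 2 * n ≤ (W0 y \ (g.erase y).biUnion W0).card := by
      have h2 := card_sdiff_add_card_inter (W0 y) ((g.erase y).biUnion W0)
      have h3 := hWc y hyY
      omega
    obtain ⟨W, hW1, hW2⟩ := exists_subset_card_eq hc
    refine ⟨W, hW1.trans sdiff_subset, hW2, fun z hz hzy => ?_⟩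
    rw [Finset.disjoint_left]
    intro v hv hv'
    have := (mem_sdiff.mp (hW1 hv)).2
    exact this (mem_biUnion.mpr ⟨z, mem_erase.mpr ⟨hzy, hz⟩, hv'⟩)
  choose! W hW1 hW2 hW3 using hW
  let B : Finset V → V → Finset V → Prop := fun g y A => y ∉ A ∧ T y ≤ ((A ∩ W g y).card : ℝ)
  have hdepW : ∀ g y, Dep (W g y) (fun A => T y ≤ ((A ∩ W g y).card : ℝ)) := by
    intro g y A A' h
    simp only [h]
  have hdepn : ∀ y : V, Dep {y} (fun A : Finset V => y ∉ A) := by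
    intro y A A' h
    have := Dep_mem y A A' h
    simp only at this
    simp only [this]
  have hdepB : ∀ g y, Dep ({y} ∪ W g y) (B g y) := by
    intro g y A A' h
    have e1 := ((hdepW g y).mono (subset_union_right (s₁ := {y}))) A A' h
    have e2 := ((hdepn y).mono (subset_union_left (s₂ := W g y))) A A' h
    simp only at e1 e2
    simp only [B, e1, e2]
  have hyW : ∀ g ∈ P, ∀ y ∈ g, ∀ z ∈ g, z ∉ W g y := by
    intro g hg y hy z hz hzW
    have := hWN y ((hP g hg).1 hy)
    exact (Finset.disjoint_left.mp this) (hW1 g hg y hy hzW) (hYN ((hP g hg).1 hz))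
  have hPB : ∀ g ∈ P, ∀ y ∈ g, q ≤ Pr p (B g y) := by
    intro g hg y hy
    have hdis : Disjoint {y} (W g y) := by
      rw [disjoint_singleton_left]; exact hyW g hg y hy y hy
    rw [Pr_and p (hdepn y) (hdepW g y) hdis, Pr_compl, Pr_mem]
    have ht := tail_lower (T := T y) n s hn h8s h0 h1 hb1 hp hpb.le (W g y) (hW2 g hg y hy) (by
      have h2 := hT y ((hP g hg).1 hy)
      have h3 : (N.card : ℝ) ≤ 2 * n + 3 * K + s + 1 := by exact_mod_cast hn2
      have h4 : 4 * (K : ℝ) + 1 ≤ s := by exact_mod_cast hsK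
      linarith)
    refine hq.trans ?_
    refine mul_le_mul (by linarith) ht ?_ (by linarith)
    have e1 : 0 ≤ 1 - 4 * b ^ 2 := by nlinarith
    have e2 : 0 ≤ 1 - 2 * b := by linarith
    positivity
  have hgroup : ∀ g ∈ P, Pr p (fun A => ((g.filter (fun y => B g y A)).card : ℝ) ≤ s * q / 2) ≤
      4 / (s * q) := by
    intro g hg
    set μ := ∑ y ∈ g, Pr p (B g y) with hμ
    have hμq : s * q ≤ μ := by
      have : ∑ y ∈ g, q ≤ μ := sum_le_sum fun y hy => hPB g hg y hy
      rw [sum_const, (hP g hg).2, nsmul_eq_mul] at this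
      exact this
    have hsq : 0 < s * q := by positivity
    have hμ0 : 0 < μ := by linarith
    have h := Pr_chebyshev h0 h1 g (B g) (by
      intro y hy z hz hyz
      refine Pr_and p (hdepB g y) (hdepB g z) ?_
      rw [disjoint_union_left, disjoint_union_right, disjoint_union_right]
      refine ⟨⟨by simpa using hyz, ?_⟩, ?_, ?_⟩
      · rw [disjoint_singleton_left]; exact hyW g hg z hz y hy
      · rw [disjoint_singleton_right]; exact hyW g hg y hy z hz
      · exact Disjoint.mono_right (hW1 g hg z hz) (hW3 g hg y hy z hz (Ne.symm hyz)))
      (a := μ / 2) (by positivity)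
    calc _ ≤ Pr p (fun A => ((g.filter (fun y => B g y A)).card : ℝ) ≤ μ - μ / 2) :=
          Pr_mono h0 h1 fun A hA => by linarith
      _ ≤ μ / (μ / 2) ^ 2 := h
      _ = 4 / μ := by field_simp; norm_num
      _ ≤ _ := by gcongr
  let Z : Finset V → ℝ := fun A =>
    ∑ g ∈ P, ind (((g.filter (fun y => B g y A)).card : ℝ) ≤ s * q / 2)
  have hZ : Pr p (fun A => (P.card : ℝ) / 2 ≤ Z A) ≤ 8 / (s * q) := by
    refine (Pr_markov h0 h1 (fun A => sum_nonneg fun g _ => ind_nonneg _)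
      (by positivity : (0 : ℝ) < (P.card : ℝ) / 2)).trans ?_
    have : Ex p Z ≤ P.card * (4 / (s * q)) := by
      simp only [Z]
      rw [Ex_sum]
      have := sum_le_card_nsmul P _ _ fun g hg => hgroup g hg
      rw [nsmul_eq_mul] at this
      exact this
    rw [div_le_iff₀ (by positivity)]
    refine this.trans (le_of_eq ?_)
    field_simp; norm_num
  refine le_trans ?_ (add_le_add hcheb hZ)
  refine le_trans ?_ (Pr_or h0 h1 _ _)
  refine Pr_mono h0 h1 fun A hA => ?_
  by_contra hcon
  rw [not_or, not_le, not_le] at hcon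
  obtain ⟨hc1, hc2⟩ := hcon
  -- counting
  have hcount : ((A ∩ N).card : ℝ) + ∑ g ∈ P, ((g.filter (fun y => B g y A)).card : ℝ) ≤
      ((N.filter (fun y => y ∈ A ∨ (y ∈ Y ∧ T y ≤ ((A ∩ W0 y).card : ℝ)))).card : ℝ) := by
    have e1 : (P.biUnion (fun g => g.filter (fun y => B g y A))).card =
        ∑ g ∈ P, (g.filter (fun y => B g y A)).card := by
      apply card_biUnion
      intro g hg h hh hgh
      exact Disjoint.mono (filter_subset _ _) (filter_subset _ _) (hPd g hg h hh hgh)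
    have e2 : Disjoint (A ∩ N) (P.biUnion (fun g => g.filter (fun y => B g y A))) := by
      rw [disjoint_biUnion_right]
      intro g hg
      rw [Finset.disjoint_left]
      intro v hv hv'
      exact (mem_filter.mp hv').2.1 (mem_inter.mp hv).1
    have e3 : (A ∩ N) ∪ (P.biUnion (fun g => g.filter (fun y => B g y A))) ⊆
        N.filter (fun y => y ∈ A ∨ (y ∈ Y ∧ T y ≤ ((A ∩ W0 y).card : ℝ))) := by
      apply union_subset (hsub A)
      intro v hv
      obtain ⟨g, hg, hv⟩ := mem_biUnion.mp hv
      obtain ⟨hvg, hB⟩ := mem_filter.mp hv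
      have hvY := (hP g hg).1 hvg
      refine mem_filter.mpr ⟨hYN hvY, Or.inr ⟨hvY, hB.2.trans ?_⟩⟩
      exact Nat.cast_le.mpr (card_le_card (inter_subset_inter_left (hW1 g hg v hvg)))
    have e4 := card_le_card e3
    rw [card_union_of_disjoint e2, e1] at e4
    exact_mod_cast e4
  have hgood : (P.card : ℝ) * (s * q) / 4 ≤
      ∑ g ∈ P, ((g.filter (fun y => B g y A)).card : ℝ) := by
    have e1 : ∀ g ∈ P, (s * q / 2) *
        (1 - ind (((g.filter (fun y => B g y A)).card : ℝ) ≤ s * q / 2)) ≤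
        ((g.filter (fun y => B g y A)).card : ℝ) := by
      intro g _
      by_cases h : ((g.filter (fun y => B g y A)).card : ℝ) ≤ s * q / 2
      · rw [ind_pos h]; simp
      · rw [ind_neg h]; linarith
    refine le_trans ?_ (sum_le_sum e1)
    rw [← mul_sum, sum_sub_distrib]
    have e2 : ∑ g ∈ P, ind (((g.filter (fun y => B g y A)).card : ℝ) ≤ s * q / 2) = Z A := rfl
    rw [e2]
    simp only [sum_const, nsmul_eq_mul, mul_one]
    have hsq : 0 < s * q := by positivity
    nlinarith only [hsq, hc2]
  have hd0 : (0 : ℝ) ≤ N.card := Nat.cast_nonneg _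
  have f1 : (N.card : ℝ) * q / 8 ≤ P.card * (s * q) / 4 := by nlinarith only [hrs, hq0]
  have f2 : 2 * ((N.card : ℝ) * b) ≤ N.card * q / 8 := by nlinarith only [hqb, hd0]
  have f3 : (N.card : ℝ) * (1 / 2 - b) ≤ N.card * p := mul_le_mul_of_nonneg_left hp hd0
  linarith

end StepA

/-! ### Graph part -/

section GraphPart

open Classical Finset

variable {V : Type} [Fintype V]

set_option linter.unusedSectionVars false

noncomputable def fs (S : Set V) : Finset V := univ.filter (· ∈ S)

lemma mem_fs {S : Set V} {v : V} : v ∈ fs S ↔ v ∈ S := by simp [fs]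

lemma coe_fs (S : Set V) : (fs S : Set V) = S := by ext v; simp [mem_fs]

lemma card_fs (S : Set V) : (fs S).card = S.ncard := by
  rw [← Set.ncard_coe_finset, coe_fs]

lemma ncard_inter_coe (S : Set V) (A : Finset V) : (S ∩ (A : Set V)).ncard = (A ∩ fs S).card := by
  rw [← card_fs]; congr 1; ext v; simp [mem_fs, and_comm]

lemma deg_eq (G : SimpleGraph V) (x : V) : deg G x = (fs (G.neighborSet x)).card := (card_fs _).symm

lemma sphere_step (G : SimpleGraph V) {x y z : V} {ℓ : ℕ} (hy : y ∈ sphere G x ℓ)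
    (hz : z ∈ G.neighborSet y) : z ∈ ball G x ℓ ∨ z ∈ sphere G x (ℓ + 1) := by
  by_cases h : z ∈ ball G x ℓ
  · exact Or.inl h
  · right
    simp only [ball, sphere, Set.mem_setOf_eq, not_le] at *
    have h1 : G.edist y z = 1 := SimpleGraph.edist_eq_one_iff_adj.mpr hz
    have h2 := G.edist_triangle (u := x) (v := y) (w := z)
    rw [hy, h1] at h2
    push_cast
    exact le_antisymm h2 (Order.add_one_le_of_lt h)

lemma sphere_one (G : SimpleGraph V) (x : V) : sphere G x 1 = G.neighborSet x := by
  ext y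
  simp [sphere, SimpleGraph.edist_eq_one_iff_adj]

lemma sphere_back (G : SimpleGraph V) {x z : V} {ℓ : ℕ} (hz : z ∈ sphere G x (ℓ + 1)) :
    ∃ y ∈ sphere G x ℓ, z ∈ G.neighborSet y := by
  simp only [sphere, Set.mem_setOf_eq] at hz
  have hne : G.edist z x ≠ ⊤ := by
    rw [SimpleGraph.edist_comm, hz]; exact ENat.coe_ne_top _
  obtain ⟨w, hw⟩ := SimpleGraph.exists_walk_of_edist_ne_top hne
  rw [SimpleGraph.edist_comm, hz] at hw
  cases w with
  | nil =>
    simp only [SimpleGraph.Walk.length_nil] at hw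
    have : (0 : ℕ) = ℓ + 1 := by exact_mod_cast hw
    omega
  | @cons _ y _ h w' =>
    refine ⟨y, ?_, h.symm⟩
    have hl : w'.length = ℓ := by
      rw [SimpleGraph.Walk.length_cons] at hw
      have : w'.length + 1 = ℓ + 1 := by exact_mod_cast hw
      omega
    have h1 : G.edist y x ≤ ℓ := by
      rw [← hl]; exact SimpleGraph.Walk.edist_le w'
    have h2 := G.edist_triangle (u := x) (v := y) (w := z)
    rw [hz, SimpleGraph.edist_eq_one_iff_adj.mpr h.symm] at h2
    simp only [sphere, Set.mem_setOf_eq]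
    rw [SimpleGraph.edist_comm] at h1
    refine le_antisymm h1 ?_
    push_cast at h2
    exact (ENat.add_le_add_iff_right (by simp)).mp h2

/-- Locality of the process. -/
lemma boot_local (G : SimpleGraph V) (A B : Set V) (i : ℕ) (v : V)
    (h : ∀ u ∈ ball G v i, u ∈ A ↔ u ∈ B) : v ∈ bootIter G A i ↔ v ∈ bootIter G B i := by
  induction i generalizing v with
  | zero => exact h v (by simp [ball])
  | succ i ih =>
    have h1 : v ∈ bootIter G A i ↔ v ∈ bootIter G B i := by
      apply ih
      intro u hu
      apply h
      simp only [ball, Set.mem_setOf_eq] at *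
      exact hu.trans (by exact_mod_cast Nat.le_succ i)
    have h2 : G.neighborSet v ∩ bootIter G A i = G.neighborSet v ∩ bootIter G B i := by
      ext w
      simp only [Set.mem_inter_iff]
      refine and_congr_right fun hw => ih w fun u hu => h u ?_
      simp only [ball, Set.mem_setOf_eq] at *
      have h3 := G.edist_triangle (u := v) (v := w) (w := u)
      rw [SimpleGraph.edist_eq_one_iff_adj.mpr hw] at h3
      refine h3.trans ?_
      push_cast
      rw [add_comm]
      gcongr
    simp only [bootIter, bootStep, Set.mem_union, Set.mem_setOf_eq, h1, h2]

lemma boot_dep (G : SimpleGraph V) (i : ℕ) (v : V) :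
    Dep (fs (ball G v i)) (fun A : Finset V => v ∉ bootIter G (A : Set V) i) := by
  intro A B hAB
  have : v ∈ bootIter G (A : Set V) i ↔ v ∈ bootIter G (B : Set V) i := by
    apply boot_local
    intro u hu
    have h1 : u ∈ A ∩ fs (ball G v i) ↔ u ∈ B ∩ fs (ball G v i) := by rw [hAB]
    simpa [mem_fs, hu] using h1
  simp only [this]

lemma deg_le_of_step (G : SimpleGraph V) (x : V) (A : Finset V) (Y : Finset V)
    (W0 : V → Finset V) (hW0 : ∀ y ∈ Y, W0 y ⊆ fs (G.neighborSet y))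
    (h : ((fs (G.neighborSet x)).card : ℝ) / 2 ≤
      (((fs (G.neighborSet x)).filter
        (fun y => y ∈ A ∨ (y ∈ Y ∧ (deg G y : ℝ) / 2 ≤ ((A ∩ W0 y).card : ℝ)))).card : ℝ)) :
    x ∈ bootIter G (A : Set V) 2 := by
  right
  show (deg G x : ℝ) / 2 ≤ _
  rw [deg_eq]
  refine h.trans ?_
  rw [← card_fs]
  refine Nat.cast_le.mpr (card_le_card ?_)
  intro y hy
  obtain ⟨hyN, hy⟩ := mem_filter.mp hy
  rw [mem_fs] at hyN ⊢
  refine ⟨hyN, ?_⟩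
  rcases hy with hy | ⟨hyY, hy⟩
  · left; exact hy
  · right
    show (deg G y : ℝ) / 2 ≤ _
    refine hy.trans ?_
    show _ ≤ (((G.neighborSet y ∩ (A : Set V)).ncard : ℕ) : ℝ)
    rw [ncard_inter_coe]
    exact Nat.cast_le.mpr (card_le_card (inter_subset_inter_left (hW0 y hyY)))

lemma stepA (K : ℕ) (ε : ℝ) (hε : 0 < ε) (hε4 : ε ≤ 1 / 4) (η : ℝ) (hη : 0 < η) :
    ∃ d0 : ℕ, ∀ (V : Type) [Fintype V] (G : SimpleGraph V), P1 K G → P2 K G → P3 K G →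
      ∀ (x : V) (p : ℝ), 0 ≤ p → p ≤ 1 → d0 ≤ deg G x →
      1 / 2 - (1 / 2 - ε) * √(Real.log (deg G x) / (deg G x)) ≤ p →
      Pr p (fun A : Finset V => x ∉ bootIter G (A : Set V) 2) ≤ η := by
  obtain ⟨d0, hd0⟩ := analytic K ε hε hε4 (η / 2) (by positivity)
  refine ⟨d0, fun V _ G hP1 hP2 hP3 x p h0 h1 hd hp => ?_⟩
  obtain ⟨s, n, b, q, hb, hb0, hb1, he1, hq0, he2, hqb, hq, hn, h8s, hsK, hn1, hn2, hs2⟩ :=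
    hd0 _ hd
  obtain ⟨D, hxD, hD⟩ := hP3 x
  obtain ⟨hD1, hD2, hD3, -⟩ := hD 1 le_rfl
  simp only [Nat.sub_self, pow_zero, mul_one] at hD1
  set N := fs (G.neighborSet x) with hN
  set Y := fs (sphere G x 1 \ D) with hY
  let W0 : V → Finset V := fun y => fs (G.neighborSet y ∩ (sphere G x 2 \ D))
  rw [deg_eq] at hn1 hn2 hs2 he1
  have hYs : ∀ y ∈ Y, y ∈ sphere G x 1 \ D := fun y hy => mem_fs.mp hy
  have hdeg : ∀ y ∈ Y, deg G y ≤ N.card + K ∧ N.card ≤ deg G y + K := by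
    intro y hy
    have := hP1 x 1 le_rfl y (hYs y hy).1
    rw [abs_le, deg_eq G x] at this
    push_cast at this
    have eN : N.card = (fs (G.neighborSet x)).card := rfl
    omega
  have key := stepA_core (T := fun y => (deg G y : ℝ) / 2) h0 h1 K s n N Y W0 ?_ ?_ ?_ ?_ ?_ ?_
    hb0 hb1 hq0 hqb hq hn h8s hsK hn1 hn2 hs2 (by rw [hb]; exact hp)
  · refine le_trans ?_ (key.trans (by linarith))
    refine Pr_mono h0 h1 fun A hA => ?_
    by_contra hcon
    rw [not_lt] at hcon
    refine hA (deg_le_of_step G x A Y W0 ?_ hcon)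
    intro y _ v hv
    rw [mem_fs] at hv ⊢
    exact hv.1
  · intro y hy
    have := (hYs y hy).1
    rw [sphere_one] at this
    exact mem_fs.mpr this
  · have : N ⊆ Y ∪ fs (D ∩ sphere G x 1) := by
      intro y hy
      rw [mem_fs, ← sphere_one] at hy
      by_cases h : y ∈ D
      · exact mem_union_right _ (mem_fs.mpr ⟨h, hy⟩)
      · exact mem_union_left _ (mem_fs.mpr ⟨hy, h⟩)
    have h2 := (card_le_card this).trans (card_union_le _ _)
    rw [card_fs (D ∩ _)] at h2
    omega
  · intro y _
    rw [Finset.disjoint_left]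
    intro v hv hv'
    rw [mem_fs] at hv hv'
    rw [← sphere_one] at hv'
    have e1 : G.edist x v = ((2 : ℕ) : ℕ∞) := hv.2.1
    have e2 : G.edist x v = ((1 : ℕ) : ℕ∞) := hv'
    rw [e1] at e2
    have : (2 : ℕ) = 1 := by exact_mod_cast e2
    omega
  · intro y hy
    have hsub : fs (G.neighborSet y) ⊆ W0 y ∪ (fs (G.neighborSet y ∩ ball G x 1) ∪
        fs (D ∩ G.neighborSet y)) := by
      intro v hv
      rw [mem_fs] at hv
      simp only [W0, mem_union, mem_fs, Set.mem_inter_iff, Set.mem_diff]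
      rcases sphere_step G (hYs y hy).1 hv with h | h
      · tauto
      · tauto
    have h2 := card_le_card hsub
    have h3 := card_union_le (W0 y) (fs (G.neighborSet y ∩ ball G x 1) ∪ fs (D ∩ G.neighborSet y))
    have h4 := card_union_le (fs (G.neighborSet y ∩ ball G x 1)) (fs (D ∩ G.neighborSet y))
    rw [card_fs (_ ∩ _), card_fs (_ ∩ _)] at h4
    have h5 := hP2 x 1 le_rfl y (hYs y hy).1
    have h6 := hD2 y (hYs y hy)
    have h7 := (hdeg y hy).2
    rw [deg_eq] at h7
    omega
  · intro y hy z hz hyz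
    have := hD3 y (hYs y hy) z (hYs z hz) hyz
    refine le_trans (le_of_eq ?_) this
    rw [← card_fs]
    congr 1
    ext v
    simp only [W0, mem_inter, mem_fs, Set.mem_inter_iff, Set.mem_diff]
    tauto
  · intro y hy
    have := (hdeg y hy).1
    have h2 : (deg G y : ℝ) ≤ N.card + K := by exact_mod_cast this
    linarith

end GraphPart

/-! ### Second part of the argument: large deviations over three spheres -/

section StepB

open Classical Finset

variable {V : Type} [Fintype V]

set_option linter.unusedSectionVars false

lemma half_bad (G : SimpleGraph V) (A : Set V) (i : ℕ) (v : V) (hv : v ∉ bootIter G A (i + 1)) :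
    deg G v < 2 * (fs (G.neighborSet v ∩ (bootIter G A i)ᶜ)).card := by
  have h1 : ¬ ((deg G v : ℝ) / 2 ≤ ((G.neighborSet v ∩ bootIter G A i).ncard : ℝ)) :=
    fun h => hv (Or.inr h)
  have h2 : 2 * (G.neighborSet v ∩ bootIter G A i).ncard < deg G v := by
    rw [not_le] at h1
    have : (2 * (G.neighborSet v ∩ bootIter G A i).ncard : ℝ) < deg G v := by linarith
    exact_mod_cast this
  have h3 : (G.neighborSet v ∩ bootIter G A i).ncard + (G.neighborSet v \ bootIter G A i).ncard
      = deg G v := Set.ncard_inter_add_ncard_diff_eq_ncard _ _ (Set.toFinite _)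
  rw [card_fs, ← Set.diff_eq]
  omega

lemma expand (K : ℕ) (G : SimpleGraph V) (hP1 : P1 K G) (hP2 : P2 K G) (A : Set V) (i ℓ : ℕ)
    (hℓ : 1 ≤ ℓ) (x : V) (hd : 6 * (K * ℓ) ≤ deg G x) (T : Finset V)
    (hT : ∀ v ∈ T, v ∈ sphere G x ℓ ∧ v ∉ bootIter G A (i + 1)) :
    T.card * deg G x ≤ 4 * (K * (ℓ + 1)) * (fs (sphere G x (ℓ + 1) ∩ (bootIter G A i)ᶜ)).card := by
  have key := card_mul_le_card_mul (s := T) (t := fs (sphere G x (ℓ + 1) ∩ (bootIter G A i)ᶜ))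
    (fun v w => w ∈ G.neighborSet v) (m := (deg G x + 3) / 4) (n := K * (ℓ + 1)) ?_ ?_
  · have : deg G x ≤ 4 * ((deg G x + 3) / 4) := by omega
    calc T.card * deg G x ≤ T.card * (4 * ((deg G x + 3) / 4)) := Nat.mul_le_mul_left _ this
      _ = 4 * (T.card * ((deg G x + 3) / 4)) := by ring
      _ ≤ _ := Nat.mul_le_mul_left 4 key
      _ = _ := by ring
  · intro v hv
    obtain ⟨hvS, hvA⟩ := hT v hv
    have h1 := half_bad G A i v hvA
    have hsub : fs (G.neighborSet v ∩ (bootIter G A i)ᶜ) ⊆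
        (fs (sphere G x (ℓ + 1) ∩ (bootIter G A i)ᶜ)).bipartiteAbove
          (fun v w => w ∈ G.neighborSet v) v ∪ fs (G.neighborSet v ∩ ball G x ℓ) := by
      intro w hw
      rw [mem_fs] at hw
      rw [mem_union, mem_bipartiteAbove, mem_fs, mem_fs]
      rcases sphere_step G hvS hw.1 with h | h
      · exact Or.inr ⟨hw.1, h⟩
      · exact Or.inl ⟨⟨h, hw.2⟩, hw.1⟩
    have h2 := (card_le_card hsub).trans (card_union_le _ _)
    rw [card_fs (_ ∩ ball G x ℓ)] at h2
    have h3 := hP2 x ℓ hℓ v hvS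
    have h4 := abs_le.mp (hP1 x ℓ hℓ v hvS)
    have h5 : ((K * ℓ : ℕ) : ℤ) = (K : ℤ) * ℓ := by push_cast; ring
    rw [← h5] at h4
    generalize K * ℓ = m at *
    omega
  · intro w hw
    rw [mem_fs] at hw
    have h1 := hP2 x (ℓ + 1) (by omega) w hw.1
    refine le_trans ?_ h1
    rw [← card_fs]
    refine card_le_card ?_
    intro v hv
    rw [mem_bipartiteBelow] at hv
    rw [mem_fs]
    refine ⟨SimpleGraph.Adj.symm hv.2, ?_⟩
    have h2 : G.edist x v = ℓ := (hT v hv.1).1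
    show G.edist x v ≤ _
    rw [h2]
    exact_mod_cast Nat.le_succ ℓ

lemma det_bad (K : ℕ) (G : SimpleGraph V) (hP1 : P1 K G) (hP2 : P2 K G) (A : Set V) (x : V)
    (hd : 12 * K ≤ deg G x) (hx : x ∉ bootIter G A 5) :
    deg G x ^ 3 ≤ 192 * K ^ 2 * (fs (sphere G x 3 ∩ (bootIter G A 2)ᶜ)).card := by
  have h1 := half_bad G A 4 x hx
  have h2 := expand K G hP1 hP2 A 3 1 le_rfl x (by omega)
    (fs (G.neighborSet x ∩ (bootIter G A 4)ᶜ)) (by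
      intro v hv
      rw [mem_fs] at hv
      rw [sphere_one]
      exact hv)
  have h3 := expand K G hP1 hP2 A 2 2 (by norm_num) x (by omega)
    (fs (sphere G x 2 ∩ (bootIter G A 3)ᶜ)) (by
      intro v hv
      rw [mem_fs] at hv
      exact hv)
  simp only [Nat.reduceAdd] at h2 h3
  generalize (fs (G.neighborSet x ∩ (bootIter G A 4)ᶜ)).card = t1 at *
  generalize (fs (sphere G x 2 ∩ (bootIter G A 3)ᶜ)).card = t2 at *
  generalize (fs (sphere G x 3 ∩ (bootIter G A 2)ᶜ)).card = t3 at *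
  generalize deg G x = d at *
  calc d ^ 3 = d * (d * d) := by ring
    _ ≤ (2 * t1) * (d * d) := Nat.mul_le_mul_right _ h1.le
    _ = 2 * d * (t1 * d) := by ring
    _ ≤ 2 * d * (4 * (K * 2) * t2) := Nat.mul_le_mul_left _ h2
    _ = 16 * K * (t2 * d) := by ring
    _ ≤ 16 * K * (4 * (K * 3) * t3) := Nat.mul_le_mul_left _ h3
    _ = _ := by ring

lemma sphere_card_succ (K : ℕ) (G : SimpleGraph V) (hP1 : P1 K G) (x : V) (ℓ : ℕ) (hℓ : 1 ≤ ℓ) :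
    (fs (sphere G x (ℓ + 1))).card ≤ (fs (sphere G x ℓ)).card * (deg G x + K * ℓ) := by
  have : fs (sphere G x (ℓ + 1)) ⊆ (fs (sphere G x ℓ)).biUnion (fun y => fs (G.neighborSet y)) := by
    intro z hz
    rw [mem_fs] at hz
    obtain ⟨y, hy, hyz⟩ := sphere_back G hz
    rw [mem_biUnion]
    exact ⟨y, mem_fs.mpr hy, mem_fs.mpr hyz⟩
  refine (card_le_card this).trans (card_biUnion_le_card_mul _ _ _ ?_)
  intro y hy
  rw [mem_fs] at hy
  rw [← deg_eq]
  have h4 := abs_le.mp (hP1 x ℓ hℓ y hy)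
  have h5 : ((K * ℓ : ℕ) : ℤ) = (K : ℤ) * ℓ := by push_cast; ring
  rw [← h5] at h4
  omega

lemma sphere_three (K : ℕ) (G : SimpleGraph V) (hP1 : P1 K G) (x : V) (hd : 2 * K ≤ deg G x) :
    (fs (sphere G x 3)).card ≤ 4 * deg G x ^ 3 := by
  have h1 : (fs (sphere G x 1)).card = deg G x := by rw [sphere_one, ← deg_eq]
  have h2 := sphere_card_succ K G hP1 x 1 le_rfl
  have h3 := sphere_card_succ K G hP1 x 2 (by norm_num)
  simp only [Nat.reduceAdd] at h2 h3
  rw [h1] at h2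
  calc _ ≤ _ := h3
    _ ≤ (deg G x * (deg G x + K * 1)) * (deg G x + K * 2) := Nat.mul_le_mul_right _ h2
    _ ≤ (deg G x * (2 * deg G x)) * (2 * deg G x) := by
        gcongr <;> omega
    _ = _ := by ring

lemma coloring (r : V → V → Prop) (hr : ∀ y, r y y) (hs : ∀ y z, r y z → r z y) (N : ℕ)
    (S : Finset V) (hN : ∀ y ∈ S, (S.filter (r y)).card ≤ N) :
    ∃ c : V → ℕ, ∀ y ∈ S, c y < N ∧ ∀ z ∈ S, y ≠ z → r y z → c y ≠ c z := by
  induction S using Finset.induction with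
  | empty => exact ⟨fun _ => 0, by simp⟩
  | insert a S ha ih =>
    obtain ⟨c, hc⟩ := ih (fun y hy => (card_le_card (filter_subset_filter _ (subset_insert a S))).trans
      (hN y (mem_insert_of_mem hy)))
    have h1 := hN a (mem_insert_self a S)
    rw [filter_insert, if_pos (hr a), card_insert_of_notMem (by simp [ha])] at h1
    have h2 : ((S.filter (r a)).image c).card < (range N).card := by
      rw [card_range]
      exact lt_of_le_of_lt card_image_le (by omega)
    obtain ⟨e, he, he'⟩ := exists_mem_notMem_of_card_lt_card h2
    have he2 : ∀ z ∈ S, r a z → c z ≠ e := by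
      intro z hz hrz h
      exact he' (mem_image.mpr ⟨z, mem_filter.mpr ⟨hz, hrz⟩, h⟩)
    refine ⟨fun v => if v = a then e else c v, ?_⟩
    intro y hy
    rw [mem_insert] at hy
    rcases hy with rfl | hy
    · refine ⟨by simpa using he, ?_⟩
      intro z hz hyz hrz
      have hz' : z ∈ S := by
        rcases mem_insert.mp hz with h | h
        · exact absurd h.symm hyz
        · exact h
      simp only [if_true, if_neg (Ne.symm hyz)]
      exact (he2 z hz' hrz).symm
    · have hya : y ≠ a := fun h => ha (h ▸ hy)
      simp only [if_neg hya]
      refine ⟨(hc y hy).1, ?_⟩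
      intro z hz hyz hrz
      rcases mem_insert.mp hz with rfl | hz
      · simp only [if_true]
        exact he2 y hy (hs _ _ hrz)
      · have hza : z ≠ a := fun h => ha (h ▸ hz)
        simp only [if_neg hza]
        exact (hc y hy).2 z hz hyz hrz

lemma balls_disjoint (G : SimpleGraph V) (y z : V) (h : z ∉ ball G y 5) :
    Disjoint (fs (ball G y 2)) (fs (ball G z 2)) := by
  rw [Finset.disjoint_left]
  intro v hv hv'
  rw [mem_fs] at hv hv'
  apply h
  simp only [ball, Set.mem_setOf_eq] at *
  have h1 := G.edist_triangle (u := y) (v := v) (w := z)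
  rw [G.edist_comm (u := v)] at h1
  refine h1.trans ((add_le_add hv hv').trans ?_)
  norm_num

/-- If a weighted number of bad vertices is large, some colour class has many bad vertices. -/
lemma pigeon (K : ℕ) (hK : 1 ≤ K) (d N : ℕ) (hd : 1 ≤ d) (hN : N = 3 * K ^ 2 * d ^ 2)
    (S : Finset V) (hS : S.card ≤ 4 * d ^ 3) (c : V → ℕ) (hc : ∀ y ∈ S, c y < N)
    (P : V → Prop) (hP : d ^ 3 ≤ 384 * K ^ 2 * (S.filter P).card) :
    ∃ i ∈ range N, ⌈((S.filter (fun y => c y = i)).card : ℝ) / (4000 * K ^ 2 : ℕ) +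
      1 / (3000 * K ^ 4) * d⌉₊ ≤ ((S.filter (fun y => c y = i)).filter P).card := by
  by_contra hcon
  push Not at hcon
  have hK0 : (0 : ℝ) < K := by exact_mod_cast hK
  have hd0 : (0 : ℝ) < d := by exact_mod_cast hd
  have h1 : (((S.filter P).card : ℕ) : ℝ) = ∑ i ∈ range N,
      (((S.filter (fun y => c y = i)).filter P).card : ℝ) := by
    rw [card_eq_sum_card_fiberwise (f := c) (t := range N)]
    · push_cast
      refine sum_congr rfl fun i _ => ?_
      rw [filter_filter, filter_filter]
      congr 2
      ext v
      simp only [mem_filter]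
      tauto
    · intro y hy
      have := mem_filter.mp (mem_coe.mp hy)
      simpa using hc y this.1
  have h2 : ((S.card : ℕ) : ℝ) = ∑ i ∈ range N, ((S.filter (fun y => c y = i)).card : ℝ) := by
    rw [card_eq_sum_card_fiberwise (f := c) (t := range N)]
    · push_cast; rfl
    · intro y hy
      simpa using hc y (mem_coe.mp hy)
  have h3 : (((S.filter P).card : ℕ) : ℝ) ≤ (S.card : ℝ) / (4000 * K ^ 2 : ℕ) +
      N * (1 / (3000 * K ^ 4) * d) := by
    rw [h1, h2, sum_div]
    calc _ ≤ ∑ i ∈ range N, (((S.filter (fun y => c y = i)).card : ℝ) / (4000 * K ^ 2 : ℕ) +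
      1 / (3000 * K ^ 4) * d) := sum_le_sum fun i hi => (Nat.lt_ceil.mp (hcon i hi)).le
      _ = _ := by
        rw [sum_add_distrib]
        simp
  have h4 : (d : ℝ) ^ 3 ≤ 384 * K ^ 2 * (S.filter P).card := by exact_mod_cast hP
  have h5 : (S.card : ℝ) ≤ 4 * d ^ 3 := by exact_mod_cast hS
  have h6 : (S.card : ℝ) / (4000 * K ^ 2 : ℕ) ≤ d ^ 3 / (1000 * K ^ 2) := by
    push_cast
    rw [div_le_div_iff₀ (by positivity) (by positivity)]
    nlinarith [sq_nonneg (K : ℝ), mul_le_mul_of_nonneg_right h5 (sq_nonneg (K : ℝ))]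
  have h7 : (N : ℝ) * (1 / (3000 * K ^ 4) * d) = d ^ 3 / (1000 * K ^ 2) := by
    rw [hN]; push_cast; field_simp; norm_num
  have h8 : (384 : ℝ) * K ^ 2 * (d ^ 3 / (1000 * K ^ 2) + d ^ 3 / (1000 * K ^ 2)) =
      (768 / 1000) * d ^ 3 := by field_simp; norm_num
  have h9 : (384 : ℝ) * K ^ 2 * (S.filter P).card ≤ 384 * K ^ 2 *
      (d ^ 3 / (1000 * K ^ 2) + d ^ 3 / (1000 * K ^ 2)) := by
    apply mul_le_mul_of_nonneg_left _ (by positivity)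
    linarith
  have h10 : (0 : ℝ) < d ^ 3 := by positivity
  linarith

lemma class_bound (K : ℕ) (hK : 1 ≤ K) (d m k : ℕ) (q : ℝ)
    (hq : q = Real.exp (-((K + 2) * (3000 * K ^ 4))) / 2 ^ (4000 * K ^ 2))
    (hk : k = ⌈(m : ℝ) / (4000 * K ^ 2 : ℕ) + 1 / (3000 * K ^ 4) * d⌉₊) :
    2 ^ m * q ^ k ≤ Real.exp (-((K + 2) * d)) := by
  have hK0 : (0 : ℝ) < K := by exact_mod_cast hK
  have hc : (m : ℝ) / (4000 * K ^ 2 : ℕ) + 1 / (3000 * K ^ 4) * d ≤ k := by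
    rw [hk]; exact Nat.le_ceil _
  have hR : (0 : ℝ) < (4000 * K ^ 2 : ℕ) := by
    push_cast; positivity
  have e1 : m ≤ 4000 * K ^ 2 * k := by
    have h1 : (m : ℝ) / (4000 * K ^ 2 : ℕ) ≤ k := by
      have : (0 : ℝ) ≤ 1 / (3000 * K ^ 4) * d := by positivity
      linarith
    rw [div_le_iff₀ hR] at h1
    have : m ≤ k * (4000 * K ^ 2) := by exact_mod_cast h1
    linarith
  have e2 : (d : ℝ) ≤ 3000 * K ^ 4 * k := by
    have h1 : 1 / (3000 * (K : ℝ) ^ 4) * d ≤ k := by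
      have : (0 : ℝ) ≤ (m : ℝ) / (4000 * K ^ 2 : ℕ) := by positivity
      linarith
    rw [one_div, inv_mul_le_iff₀ (by positivity)] at h1
    exact h1
  calc (2 : ℝ) ^ m * q ^ k ≤ 2 ^ (4000 * K ^ 2 * k) * q ^ k := by
        apply mul_le_mul_of_nonneg_right _ (by rw [hq]; positivity)
        exact pow_le_pow_right₀ (by norm_num) e1
    _ = (2 ^ (4000 * K ^ 2) * q) ^ k := by rw [pow_mul, mul_pow]
    _ = Real.exp (-((K + 2) * (3000 * K ^ 4))) ^ k := by
        rw [hq, mul_div_cancel₀ _ (by positivity)]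
    _ = Real.exp (k * -((K + 2) * (3000 * K ^ 4))) := (Real.exp_nat_mul _ _).symm
    _ ≤ _ := by
        apply Real.exp_le_exp.mpr
        have : ((K : ℝ) + 2) * d ≤ (K + 2) * (3000 * K ^ 4 * k) :=
          mul_le_mul_of_nonneg_left e2 (by positivity)
        linarith

lemma union_num (K d : ℕ) (hd : 24 ≤ d) (hd2 : 3 * K ^ 2 ≤ d) :
    ((3 * K ^ 2 * d ^ 2 : ℕ) : ℝ) * Real.exp (-((K + 2) * d)) ≤ Real.exp (-((K + 1) * d)) := by
  have h1 : (3 * K ^ 2 * d ^ 2 : ℕ) ≤ d ^ 3 := by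
    calc _ ≤ d * d ^ 2 := Nat.mul_le_mul_right _ hd2
      _ = _ := by ring
  have h2 : ((3 * K ^ 2 * d ^ 2 : ℕ) : ℝ) ≤ (d : ℝ) ^ 3 := by exact_mod_cast h1
  have h3 := Real.pow_div_factorial_le_exp (d : ℝ) (by positivity) 4
  have h4 : (d : ℝ) ^ 3 ≤ d ^ 4 / (Nat.factorial 4 : ℕ) := by
    have : (24 : ℝ) ≤ d := by exact_mod_cast hd
    rw [show Nat.factorial 4 = 24 from rfl]
    rw [le_div_iff₀ (by norm_num)]
    push_cast
    have h5 : (0 : ℝ) ≤ (d : ℝ) ^ 3 := by positivity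
    nlinarith [mul_le_mul_of_nonneg_left this h5]
  calc _ ≤ Real.exp d * Real.exp (-((K + 2) * d)) := by
        apply mul_le_mul_of_nonneg_right _ (Real.exp_nonneg _)
        linarith
    _ = _ := by rw [← Real.exp_add]; congr 1; ring

lemma stepB (K : ℕ) (hK : 1 ≤ K) :
    ∃ q0 : ℝ, 0 < q0 ∧ ∃ d1 : ℕ, ∀ (V : Type) [Fintype V] (G : SimpleGraph V),
      P1 K G → P2 K G → P3 K G →
      ∀ (x : V) (p : ℝ), 0 ≤ p → p ≤ 1 → d1 ≤ deg G x →
      (∀ y, Pr p (fun A : Finset V => y ∉ bootIter G (A : Set V) 2) ≤ q0) →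
      Pr p (fun A : Finset V => x ∉ bootIter G (A : Set V) 5) ≤
        Real.exp (-((K + 1) * deg G x)) := by
  refine ⟨Real.exp (-((K + 2) * (3000 * K ^ 4))) / 2 ^ (4000 * K ^ 2), by positivity,
    24 + 12 * K + 3 * K ^ 2 + 384 * K ^ 4, ?_⟩
  intro V _ G hP1 hP2 hP3 x p h0 h1 hd hq
  set q := Real.exp (-((K + 2) * (3000 * K ^ 4))) / 2 ^ (4000 * K ^ 2) with hqdef
  have hq0 : 0 < q := by positivity
  have hq1 : q ≤ 1 := by
    rw [hqdef, div_le_one (by positivity)]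
    have a1 : Real.exp (-((K + 2) * (3000 * K ^ 4))) ≤ 1 := by
      rw [Real.exp_le_one_iff, neg_nonpos]; positivity
    exact a1.trans (one_le_pow₀ (by norm_num))
  obtain ⟨D, -, hD⟩ := hP3 x
  obtain ⟨hD1, -, -, hD4⟩ := hD 3 (by norm_num)
  simp only [Nat.reduceSub, Nat.reduceMul] at hD1 hD4
  obtain ⟨d, hdd⟩ : ∃ d, d = deg G x := ⟨_, rfl⟩
  have hs3 := sphere_three K G hP1 x (by omega)
  have hdet := fun A : Set V => det_bad K G hP1 hP2 A x (by omega)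
  simp only [← hdd] at hd hD1 hD4 hs3 hdet ⊢
  set S := fs (sphere G x 3 \ D) with hSdef
  have hScard : S.card ≤ 4 * d ^ 3 := by
    refine le_trans (card_le_card ?_) hs3
    intro v hv
    rw [mem_fs] at hv ⊢
    exact hv.1
  obtain ⟨c, hc⟩ := coloring (fun y z => z ∈ ball G y 5) (fun y => by simp [ball])
    (fun y z h => by simpa [ball, G.edist_comm] using h) (3 * K ^ 2 * d ^ 2) S (by
      intro y hy
      have := hD4 y (mem_fs.mp hy)
      rw [← card_fs] at this
      refine le_trans (card_le_card ?_) this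
      intro z hz
      rw [mem_filter] at hz
      rw [mem_fs]
      exact ⟨hz.2, mem_fs.mp hz.1⟩)
  have hbad : ∀ A : Finset V, x ∉ bootIter G (A : Set V) 5 →
      d ^ 3 ≤ 384 * K ^ 2 * (S.filter (fun y => y ∉ bootIter G (A : Set V) 2)).card := by
    intro A hA
    have a1 := hdet A hA
    have a2 : fs (sphere G x 3 ∩ (bootIter G (A : Set V) 2)ᶜ) ⊆
        (S.filter (fun y => y ∉ bootIter G (A : Set V) 2)) ∪ fs (D ∩ sphere G x 3) := by
      intro v hv
      rw [mem_fs] at hv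
      rw [mem_union, mem_filter, mem_fs, mem_fs]
      by_cases h : v ∈ D
      · exact Or.inr ⟨h, hv.1⟩
      · exact Or.inl ⟨⟨hv.1, h⟩, hv.2⟩
    have a3 := (card_le_card a2).trans (card_union_le _ _)
    rw [card_fs (D ∩ _)] at a3
    generalize (fs (sphere G x 3 ∩ (bootIter G (A : Set V) 2)ᶜ)).card = t at *
    generalize (S.filter (fun y => y ∉ bootIter G (A : Set V) 2)).card = b at *
    have a4 : t ≤ b + K ^ 2 * d ^ 2 := by omega
    have a5 : 192 * K ^ 2 * t ≤ 192 * K ^ 2 * (b + K ^ 2 * d ^ 2) := Nat.mul_le_mul_left _ a4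
    have a6 : 384 * K ^ 4 * d ^ 2 ≤ d * d ^ 2 := Nat.mul_le_mul_right _ (by omega)
    nlinarith
  calc _ ≤ Pr p (fun A : Finset V => ∃ i ∈ range (3 * K ^ 2 * d ^ 2),
        ⌈((S.filter (fun y => c y = i)).card : ℝ) / (4000 * K ^ 2 : ℕ) +
          1 / (3000 * K ^ 4) * d⌉₊ ≤ ((S.filter (fun y => c y = i)).filter
            (fun y => y ∉ bootIter G (A : Set V) 2)).card) := by
        refine Pr_mono h0 h1 fun A hA => ?_
        have hb := hbad A hA
        have := pigeon K hK d _ (by omega) rfl S hScard c (fun y hy => (hc y hy).1)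
          (fun y => y ∉ bootIter G (A : Set V) 2) (by convert hb)
        convert this
    _ ≤ _ := Pr_exists h0 h1 _ _
    _ ≤ ∑ i ∈ range (3 * K ^ 2 * d ^ 2), Real.exp (-((K + 2) * d)) := by
        refine sum_le_sum fun i _ => ?_
        refine (Pr_many h0 h1 (S.filter (fun y => c y = i))
          (fun y (A : Finset V) => y ∉ bootIter G (A : Set V) 2) (fun y => fs (ball G y 2))
          (fun y => boot_dep G 2 y) ?_ hq0.le hq1 (fun y _ => hq y) _).trans
          (class_bound K hK d _ _ q hqdef rfl)
        intro y hy z hz hyz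
        rw [mem_filter] at hy hz
        apply balls_disjoint
        intro h
        exact (hc y hy.1).2 z hz.1 hyz h (hy.2.trans hz.2.symm)
    _ = ((3 * K ^ 2 * d ^ 2 : ℕ) : ℝ) * Real.exp (-((K + 2) * d)) := by
        rw [sum_const, card_range, nsmul_eq_mul]
    _ ≤ _ := union_num K d (by omega) (by omega)

end StepB

/-! ### Assembly -/

section Assembly

open Classical Finset

variable {V : Type} [Fintype V]

set_option linter.unusedSectionVars false

lemma minDeg_le (G : SimpleGraph V) (x : V) : minDeg G ≤ deg G x :=
  Nat.sInf_le ⟨x, rfl⟩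

lemma le_maxDeg (G : SimpleGraph V) (x : V) : deg G x ≤ maxDeg G :=
  le_csSup (Set.finite_range _).bddAbove ⟨x, rfl⟩

lemma exists_of_minDeg (G : SimpleGraph V) (h : 1 ≤ minDeg G) : ∃ x y : V, G.Adj x y := by
  have hne : Nonempty V := by
    by_contra hV
    rw [not_nonempty_iff] at hV
    have : minDeg G = 0 := by simp [minDeg, Set.range_eq_empty]
    omega
  obtain ⟨x⟩ := hne
  have h1 := h.trans (minDeg_le G x)
  rw [deg_eq] at h1
  obtain ⟨y, hy⟩ := card_pos.mp h1
  exact ⟨x, y, mem_fs.mp hy⟩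

lemma InH_props (K : ℕ) (G : SimpleGraph V) (hG : InH K G) (h : 1 ≤ minDeg G) :
    1 ≤ K ∧ P1 K G ∧ P2 K G ∧ P3 K G ∧ P5 K G := by
  obtain ⟨x, y, hxy⟩ := exists_of_minDeg G h
  have hcard : Nat.card V ≠ 1 := by
    intro hc
    obtain ⟨hs, -⟩ := Nat.card_eq_one_iff_unique.mp hc
    exact hxy.ne (Subsingleton.elim x y)
  obtain ⟨n, hn⟩ := hG
  have : P1 K G ∧ P2 K G ∧ P3 K G ∧ P5 K G := by
    cases n with
    | zero => exact absurd hn hcard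
    | succ n =>
      rcases hn with hn | ⟨a, b, c, -, e⟩
      · exact absurd hn hcard
      · exact ⟨a, b, c, e⟩
  refine ⟨?_, this⟩
  have h2 := this.2.1 x 1 le_rfl y (by rw [sphere_one]; exact hxy)
  rw [← card_fs] at h2
  have h3 : 0 < (fs (G.neighborSet y ∩ ball G x 1)).card :=
    card_pos.mpr ⟨x, mem_fs.mpr ⟨hxy.symm, by simp [ball]⟩⟩
  omega

lemma Phi_eq (p : ℝ) (G : SimpleGraph V) :
    Phi p G = Pr p (fun A : Finset V => Percolates G (A : Set V)) := prob_eq_Pr p _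

lemma Phi_le_one (G : SimpleGraph V) {p : ℝ} (h0 : 0 ≤ p) (h1 : p ≤ 1) : Phi p G ≤ 1 := by
  rw [Phi_eq]
  have a := Pr_compl p (fun A : Finset V => Percolates G (A : Set V))
  have b := Pr_nonneg h0 h1 (fun A : Finset V => ¬ Percolates G (A : Set V))
  linarith

lemma low_mono (ε : ℝ) (d D : ℕ) (hd : 3 ≤ d) (hD : d ≤ D) (p : ℝ)
    (hp : 1 / 2 - (1 / 2 - ε) * √(Real.log D / D) ≤ p) :
    1 / 2 - (1 / 2 - min ε (1 / 4)) * √(Real.log d / d) ≤ p := by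
  have hd3 : (3 : ℝ) ≤ d := by exact_mod_cast hd
  have hdD : (d : ℝ) ≤ D := by exact_mod_cast hD
  have he : Real.exp 1 ≤ d := by linarith [Real.exp_one_lt_d9]
  have h1 : Real.log D / D ≤ Real.log d / d :=
    Real.log_div_self_antitoneOn he (he.trans hdD) hdD
  have h2 : √(Real.log D / D) ≤ √(Real.log d / d) := Real.sqrt_le_sqrt h1
  have h3 : (0 : ℝ) ≤ √(Real.log D / D) := Real.sqrt_nonneg _
  have h4 : min ε (1 / 4) ≤ ε := min_le_left _ _
  have h5 : min ε (1 / 4) ≤ 1 / 4 := min_le_right _ _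
  have h6 : (1 / 2 - ε) * √(Real.log D / D) ≤ (1 / 2 - min ε (1 / 4)) * √(Real.log d / d) :=
    mul_le_mul (by linarith) h2 h3 (by linarith)
  linarith

lemma final_bound (K : ℕ) (ε : ℝ) (hε : 0 < ε) (d0 d1 : ℕ) (q0 : ℝ)
    (hd0 : ∀ (V : Type) [Fintype V] (G : SimpleGraph V), P1 K G → P2 K G → P3 K G →
      ∀ (x : V) (p : ℝ), 0 ≤ p → p ≤ 1 → d0 ≤ deg G x →
      1 / 2 - (1 / 2 - min ε (1 / 4)) * √(Real.log (deg G x) / (deg G x)) ≤ p →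
      Pr p (fun A : Finset V => x ∉ bootIter G (A : Set V) 2) ≤ q0)
    (hd1 : ∀ (V : Type) [Fintype V] (G : SimpleGraph V),
      P1 K G → P2 K G → P3 K G →
      ∀ (x : V) (p : ℝ), 0 ≤ p → p ≤ 1 → d1 ≤ deg G x →
      (∀ y, Pr p (fun A : Finset V => y ∉ bootIter G (A : Set V) 2) ≤ q0) →
      Pr p (fun A : Finset V => x ∉ bootIter G (A : Set V) 5) ≤
        Real.exp (-((K + 1) * deg G x)))
    (G : SimpleGraph V) (hP1 : P1 K G) (hP2 : P2 K G) (hP3 : P3 K G) (hP5 : P5 K G)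
    (p : ℝ) (h0 : 0 ≤ p) (h1 : p ≤ 1) (hn : d0 + d1 + 3 ≤ minDeg G)
    (hlow : 1 / 2 - (1 / 2 - ε) * √(Real.log (maxDeg G) / (maxDeg G)) ≤ p) :
    1 - Real.exp (-(minDeg G : ℝ)) ≤ Phi p G := by
  have hA : ∀ y, Pr p (fun A : Finset V => y ∉ bootIter G (A : Set V) 2) ≤ q0 := by
    intro y
    have := minDeg_le G y
    exact hd0 V G hP1 hP2 hP3 y p h0 h1 (by omega)
      (low_mono ε _ _ (by omega) (le_maxDeg G y) p hlow)
  have hB : ∀ x, Pr p (fun A : Finset V => x ∉ bootIter G (A : Set V) 5) ≤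
      Real.exp (-((K + 1) * minDeg G)) := by
    intro x
    have := minDeg_le G x
    refine (hd1 V G hP1 hP2 hP3 x p h0 h1 (by omega) hA).trans ?_
    apply Real.exp_le_exp.mpr
    have h2 : (minDeg G : ℝ) ≤ deg G x := by exact_mod_cast this
    have h3 : ((K : ℝ) + 1) * minDeg G ≤ (K + 1) * deg G x :=
      mul_le_mul_of_nonneg_left h2 (by positivity)
    linarith
  have hC : Pr p (fun A : Finset V => ¬ Percolates G (A : Set V)) ≤ Real.exp (-(minDeg G : ℝ)) := by
    calc _ ≤ Pr p (fun A : Finset V => ∃ x ∈ (univ : Finset V), x ∉ bootIter G (A : Set V) 5) := by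
          refine Pr_mono h0 h1 fun A hA => ?_
          by_contra hcon
          push Not at hcon
          apply hA
          exact Set.eq_univ_of_forall fun x => Set.mem_iUnion.mpr ⟨5, hcon x (mem_univ x)⟩
      _ ≤ ∑ x : V, Pr p (fun A : Finset V => x ∉ bootIter G (A : Set V) 5) := Pr_exists h0 h1 _ _
      _ ≤ ∑ _x : V, Real.exp (-((K + 1) * minDeg G)) := sum_le_sum fun x _ => hB x
      _ = (Nat.card V : ℝ) * Real.exp (-((K + 1) * minDeg G)) := by
          rw [sum_const, nsmul_eq_mul, card_univ, Nat.card_eq_fintype_card]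
      _ ≤ Real.exp (K * minDeg G) * Real.exp (-((K + 1) * minDeg G)) :=
          mul_le_mul_of_nonneg_right hP5 (Real.exp_nonneg _)
      _ = _ := by rw [← Real.exp_add]; congr 1; ring
  rw [Pr_compl, ← Phi_eq] at hC
  linarith

end Assembly

/-- 1-statement of the main theorem. -/
theorem statement0 (K : ℕ) (ε : ℝ) (hε : 0 < ε)
    (V : ℕ → Type) (hfin : ∀ n, Finite (V n))
    (G : ∀ n, SimpleGraph (V n))
    (hH : ∀ n, InH K (G n))
    (hδ : Tendsto (fun n => minDeg (G n)) atTop atTop)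
    (p : ℕ → ℝ) (hp : ∀ n, p n ∈ Set.Icc (0 : ℝ) 1)
    (hlow : ∀ n, 1 / 2 - (1 / 2 - ε) *
        Real.sqrt (Real.log (maxDeg (G n)) / (maxDeg (G n))) < p n) :
    Tendsto (fun n => Phi (p n) (G n)) atTop (nhds 1) := by
  rcases Nat.eq_zero_or_pos K with hK0 | hK
  · -- the case `K = 0` is vacuous
    exfalso
    obtain ⟨n, hn⟩ := (hδ.eventually_ge_atTop 1).exists
    haveI := hfin n
    haveI : Fintype (V n) := Fintype.ofFinite _
    exact absurd hn (by
      have := InH_props K (G n) (hH n) hn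
      omega)
  obtain ⟨q0, hq0, d1, hd1⟩ := stepB K hK
  obtain ⟨d0, hd0⟩ := stepA K (min ε (1 / 4)) (by positivity) (min_le_right _ _) q0 hq0
  have hlim : Tendsto (fun n => 1 - Real.exp (-(minDeg (G n) : ℝ))) atTop (nhds 1) := by
    have h1 : Tendsto (fun n => Real.exp (-(minDeg (G n) : ℝ))) atTop (nhds 0) :=
      Real.tendsto_exp_neg_atTop_nhds_zero.comp (tendsto_natCast_atTop_atTop.comp hδ)
    simpa using h1.const_sub 1
  refine tendsto_of_tendsto_of_tendsto_of_le_of_le' hlim tendsto_const_nhds ?_ ?_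
  · filter_upwards [hδ.eventually_ge_atTop (d0 + d1 + 3)] with n hn
    haveI := hfin n
    haveI : Fintype (V n) := Fintype.ofFinite _
    obtain ⟨-, hP1, hP2, hP3, hP5⟩ := InH_props K (G n) (hH n) (by omega)
    exact final_bound K ε hε d0 d1 q0 hd0 hd1 (G n) hP1 hP2 hP3 hP5 (p n) (hp n).1 (hp n).2
      hn (hlow n).le
  · refine Eventually.of_forall fun n => ?_
    haveI := hfin n
    haveI : Fintype (V n) := Fintype.ofFinite _
    exact Phi_le_one (G n) (hp n).1 (hp n).2

end MBP
end

section
/- Let K ∈ ℕ and let G be a finite simple graph satisfying property (P3) [typical local structure and K-separation] with parameter K. Then for every x ∈ V(G) and every ℓ ≥ 1 there exists a partition S(x,ℓ) = P₁ ∪ ⋯ ∪ P_m of the sphere S(x,ℓ) into m pairwise disjoint sets such that m ≤ (ℓ+1)·K^{ℓ−1}·d(x)^{ℓ−1} and dist(y₁, y₂) ≥ 2ℓ for all j ∈ [m] and all distinct y₁, y₂ ∈ P_j. -/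
open SimpleGraph Filter

namespace MBP

/-- Greedy colouring: if every closed neighbourhood in `S` has at most `M` elements, then `S`
can be properly coloured with `M` colours. -/
theorem greedy_colour {V : Type} [Finite V] (r : V → V → Prop) (hr : ∀ a b, r a b → r b a)
    (M : ℕ) (S : Set V) (hS : ∀ y ∈ S, ({z | z = y ∨ r y z} ∩ S).ncard ≤ M) :
    ∃ c : V → ℕ, (∀ y ∈ S, c y < M) ∧ ∀ y ∈ S, ∀ z ∈ S, y ≠ z → r y z → c y ≠ c z := by
  classical
  induction S, S.toFinite using Set.Finite.induction_on with
  | empty => exact ⟨fun _ => 0, by simp, by simp⟩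
  | @insert a S ha hfin ih =>
    obtain ⟨c, hc1, hc2⟩ := ih (fun y hy =>
      (Set.ncard_le_ncard (Set.inter_subset_inter_right _ (Set.subset_insert a S))
        (Set.toFinite _)).trans (hS y (Set.mem_insert_of_mem _ hy)))
    have h1 : ({z | r a z} ∩ S).ncard < M := by
      refine lt_of_lt_of_le ?_ (hS a (Set.mem_insert _ _))
      apply Set.ncard_lt_ncard _ (Set.toFinite _)
      refine ⟨fun z hz => ⟨Or.inr hz.1, Or.inr hz.2⟩, fun h => ?_⟩
      exact ha (h ⟨Or.inl rfl, Or.inl rfl⟩ : a ∈ {z | r a z} ∩ S).2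
    have h2 : ∃ k, k < M ∧ k ∉ c '' ({z | r a z} ∩ S) := by
      by_contra hcon
      push Not at hcon
      have h3 : (Set.Iio M) ⊆ c '' ({z | r a z} ∩ S) := fun k hk => hcon k hk
      have h4 := Set.ncard_le_ncard h3 (Set.toFinite _)
      have h5 : (c '' ({z | r a z} ∩ S)).ncard ≤ ({z | r a z} ∩ S).ncard :=
        Set.ncard_image_le (Set.toFinite _)
      have h6 : (Set.Iio M).ncard = M := by
        rw [← Finset.coe_range, Set.ncard_coe_finset, Finset.card_range]
      omega
    obtain ⟨k, hkM, hk⟩ := h2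
    have hne : ∀ y ∈ S, y ≠ a := fun y hy h => ha (h ▸ hy)
    refine ⟨Function.update c a k, ?_, ?_⟩
    · rintro y (rfl | hy)
      · simpa using hkM
      · rw [Function.update_of_ne (hne y hy)]; exact hc1 y hy
    · rintro y (rfl | hy) z (rfl | hz) hyz hryz
      · exact absurd rfl hyz
      · rw [Function.update_self, Function.update_of_ne (hne z hz)]
        exact fun h => hk ⟨z, ⟨hryz, hz⟩, h.symm⟩
      · rw [Function.update_self, Function.update_of_ne (hne y hy)]
        exact fun h => hk ⟨y, ⟨hr _ _ hryz, hy⟩, h⟩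
      · rw [Function.update_of_ne (hne y hy), Function.update_of_ne (hne z hz)]
        exact hc2 y hy z hz hyz hryz

/-- separating partition lemma. -/
theorem statement3 (K : ℕ) (V : Type) [Finite V] (G : SimpleGraph V)
    (hP3 : P3 K G) (x : V) (ℓ : ℕ) (hℓ : 1 ≤ ℓ) :
    ∃ (m : ℕ) (P : Fin m → Set V),
      (Pairwise fun i j => Disjoint (P i) (P j)) ∧
      (⋃ i, P i) = sphere G x ℓ ∧
      m ≤ (ℓ + 1) * K ^ (ℓ - 1) * (deg G x) ^ (ℓ - 1) ∧
      (∀ i, ∀ y₁ ∈ P i, ∀ y₂ ∈ P i, y₁ ≠ y₂ →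
        ((2 * ℓ : ℕ) : ℕ∞) ≤ G.edist y₁ y₂) := by
  classical
  obtain ⟨D, -, hD⟩ := hP3 x
  obtain ⟨h1, -, -, h4⟩ := hD ℓ hℓ
  obtain ⟨c, hc1, hc2⟩ := greedy_colour (fun y z => G.edist y z ≤ ((2 * ℓ - 1 : ℕ) : ℕ∞))
    (fun a b h => by rw [SimpleGraph.edist_comm]; exact h)
    (ℓ * K ^ (ℓ - 1) * (deg G x) ^ (ℓ - 1)) (sphere G x ℓ \ D) (by
      intro y hy
      refine le_trans (Set.ncard_le_ncard ?_ (Set.toFinite _)) (h4 y hy)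
      rintro z ⟨rfl | hz, hzS⟩
      · exact ⟨by simp [ball], hzS⟩
      · exact ⟨hz, hzS⟩)
  obtain ⟨e, he1, he2⟩ := greedy_colour (fun _ _ : V => True) (fun _ _ h => h)
    (K ^ (ℓ - 1) * (deg G x) ^ (ℓ - 1)) (D ∩ sphere G x ℓ) (by
      intro y hy
      exact le_trans (Set.ncard_le_ncard Set.inter_subset_right (Set.toFinite _)) h1)
  set M := ℓ * K ^ (ℓ - 1) * (deg G x) ^ (ℓ - 1) with hM
  set N := K ^ (ℓ - 1) * (deg G x) ^ (ℓ - 1) with hN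
  let f : V → ℕ := fun y => if y ∈ D then M + e y else c y
  refine ⟨M + N, fun i => {y | y ∈ sphere G x ℓ ∧ f y = i}, ?_, ?_, ?_, ?_⟩
  · intro i j hij
    rw [Set.disjoint_left]
    rintro y ⟨-, hy⟩ ⟨-, hy'⟩
    exact hij (Fin.ext (hy.symm.trans hy'))
  · ext y
    simp only [Set.mem_iUnion, Set.mem_setOf_eq]
    refine ⟨fun ⟨_, h, _⟩ => h, fun h => ?_⟩
    have hf : f y < M + N := by
      by_cases hy : y ∈ D
      · have := he1 y ⟨hy, h⟩
        simp only [f, if_pos hy]; omega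
      · have := hc1 y ⟨h, hy⟩
        simp only [f, if_neg hy]; omega
    exact ⟨⟨f y, hf⟩, h, rfl⟩
  · apply le_of_eq
    rw [hM, hN]; ring
  · rintro i y ⟨hy, hyi⟩ z ⟨hz, hzi⟩ hyz
    have hfe : f y = f z := hyi.trans hzi.symm
    by_cases hyD : y ∈ D <;> by_cases hzD : z ∈ D <;>
      simp only [f, hyD, hzD, if_true, if_false] at hfe
    · exact absurd (by omega) (he2 y ⟨hyD, hy⟩ z ⟨hzD, hz⟩ hyz trivial)
    · have := hc1 z ⟨hz, hzD⟩
      omega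
    · have := hc1 y ⟨hy, hyD⟩
      omega
    · by_contra hlt
      refine hc2 y ⟨hy, hyD⟩ z ⟨hz, hzD⟩ hyz ?_ hfe
      rw [not_le] at hlt
      have h7 : ((2 * ℓ : ℕ) : ℕ∞) = ((2 * ℓ - 1 : ℕ) : ℕ∞) + 1 := by
        rw [← Nat.cast_succ]; congr 1; omega
      rw [h7] at hlt
      exact Order.le_of_lt_add_one hlt

end MBP
end
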